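/- arXiv:1504.06380 — 2 statements merged into one kernel-verified Lean document; each statement's English description precedes it below -/
import Mathlib

section
/- Let P_ℓ(x,D) = Σ_{j,k} a^ℓ_jk(x)∂²_{jk}, ℓ = 1,2, be uniformly elliptic second-order operators on a neighborhood of 0 in ℝ³ with coefficients in the Gevrey class G^s. Assume α > 0 satisfies α > (λ₃^ℓ − λ₁^ℓ)/λ₁^ℓ for ℓ = 1,2, where λ₁^ℓ ≤ λ₂^ℓ ≤ λ₃^ℓ are the eigenvalues of (a^ℓ_jk(0)), and that s < 1 + 1/α. Then there exist τ₀ > 0, r₀ > 0 and C > 0 such that for every τ > τ₀ and every smooth V : ℝ³ → ℝ⁷ compactly supported in B(0,r₀)∖{0}: Σ_{j=0}^{4} τ^{6−2j} ∫ |x|^{−8−6α} |x|^{2j(1+α)} e^{2τ|x|^{−α}} |D^j V|² dx ≤ C ∫ e^{2τ|x|^{−α}} |P₂P₁ V|² dx. -/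
open MeasureTheory Metric Finset

noncomputable section

/-- `ℝ³` with the Euclidean norm. -/
abbrev E3 := EuclideanSpace ℝ (Fin 3)
/-- `ℝ⁷` with the Euclidean norm. -/
abbrev E7 := EuclideanSpace ℝ (Fin 7)

/-- The partial derivative `∂_i f`. -/
def pd (i : Fin 3) (f : E3 → ℝ) : E3 → ℝ :=
  fun x => fderiv ℝ f x (EuclideanSpace.single i 1)

/-- The multiindex partial derivative `∂^β f`. -/
def mpd (β : Fin 3 → ℕ) (f : E3 → ℝ) : E3 → ℝ :=
  (pd 0)^[β 0] ((pd 1)^[β 1] ((pd 2)^[β 2] f))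

/-- The length `|β|` of a multiindex. -/
def mdeg (β : Fin 3 → ℕ) : ℕ := β 0 + β 1 + β 2

/-- `f` belongs to the Gevrey class `G^s(Ω)`. -/
def GevreyOn (s : ℝ) (Ω : Set E3) (f : E3 → ℝ) : Prop :=
  ContDiffOn ℝ (⊤ : ℕ∞) f Ω ∧ ∃ c > 0, ∃ A > 0, ∀ β : Fin 3 → ℕ, ∀ x ∈ Ω,
    |mpd β f x| ≤ c * A ^ mdeg β * (Nat.factorial (mdeg β) : ℝ) ^ s

/-- The second-order operator `Σ_{j,k} a_jk(x) ∂²_{jk}` applied to a scalar function. -/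
def op2 (a : Fin 3 → Fin 3 → E3 → ℝ) (f : E3 → ℝ) : E3 → ℝ :=
  fun x => ∑ j, ∑ k, a j k x * pd j (pd k f) x

/-- Uniform (strong) ellipticity of `Σ_{j,k} a_jk(x) ∂²_{jk}` on `Ω`. -/
def UnifElliptic (a : Fin 3 → Fin 3 → E3 → ℝ) (Ω : Set E3) : Prop :=
  ∃ c0 > 0, ∀ x ∈ Ω, ∀ ξ : Fin 3 → ℝ,
    c0 * (∑ i, ξ i ^ 2) ≤ ∑ j, ∑ k, a j k x * ξ j * ξ k

/-- The coefficient matrix of the operator at a point. -/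
def coefMatrix (a : Fin 3 → Fin 3 → E3 → ℝ) (x : E3) : Matrix (Fin 3) (Fin 3) ℝ :=
  Matrix.of fun j k => a j k x

/-- `α > (λ₃ - λ₁)/λ₁` where `λ₁ ≤ λ₂ ≤ λ₃` are the eigenvalues of the coefficient
matrix at `0`: equivalently (the eigenvalues being positive), for any pair of
eigenvalues the corresponding ratio is `< α`. -/
def EigCond (a : Fin 3 → Fin 3 → E3 → ℝ) (α : ℝ) : Prop :=
  ∀ h : (coefMatrix a 0).IsHermitian, ∀ i j : Fin 3,
    (h.eigenvalues i - h.eigenvalues j) / h.eigenvalues j < α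

/-- The coefficients `a¹_jk = μ δ_jk + t_jk` of `P₁`. -/
def a1coef (t : Fin 3 → Fin 3 → E3 → ℝ) (mu : E3 → ℝ) : Fin 3 → Fin 3 → E3 → ℝ :=
  fun j k x => mu x * (if j = k then 1 else 0) + t j k x

/-- The coefficients `a²_jk = (λ + 2μ) δ_jk + t_jk` of `P₂`. -/
def a2coef (t : Fin 3 → Fin 3 → E3 → ℝ) (lam mu : E3 → ℝ) : Fin 3 → Fin 3 → E3 → ℝ :=
  fun j k x => (lam x + 2 * mu x) * (if j = k then 1 else 0) + t j k x

/-- The divergence `∇·u`. -/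
def divg (u : E3 → Fin 3 → ℝ) (x : E3) : ℝ := ∑ i, pd i (fun y => u y i) x

/-- The curl `∇×u`. -/
def curl (u : E3 → Fin 3 → ℝ) (x : E3) : Fin 3 → ℝ :=
  ![pd 1 (fun y => u y 2) x - pd 2 (fun y => u y 1) x,
    pd 2 (fun y => u y 0) x - pd 0 (fun y => u y 2) x,
    pd 0 (fun y => u y 1) x - pd 1 (fun y => u y 0) x]

/-- The infinitesimal strain `E = (∇u + (∇u)ᵗ)/2`. -/
def strain (u : E3 → Fin 3 → ℝ) (x : E3) (i j : Fin 3) : ℝ :=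
  (pd j (fun y => u y i) x + pd i (fun y => u y j) x) / 2

/-- The stress tensor `σ = T + (∇u)T + λ(tr E)I + 2μE`. -/
def stress (t : Fin 3 → Fin 3 → E3 → ℝ) (lam mu : E3 → ℝ) (u : E3 → Fin 3 → ℝ)
    (x : E3) (i j : Fin 3) : ℝ :=
  t i j x + (∑ k, pd k (fun y => u y i) x * t k j x)
    + lam x * divg u x * (if i = j then 1 else 0)
    + 2 * mu x * strain u x i j

/-- The residual stress system `∇·σ + κ²ρu = 0` on `Ω`. -/
def ResSystem (t : Fin 3 → Fin 3 → E3 → ℝ) (lam mu rho : E3 → ℝ) (κ : ℝ)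
    (u : E3 → Fin 3 → ℝ) (Ω : Set E3) : Prop :=
  ∀ x ∈ Ω, ∀ i : Fin 3,
    (∑ j, pd j (fun y => stress t lam mu u y i j) x) + κ ^ 2 * rho x * u x i = 0

/-- The vector `U = (u, ∇·u, ∇×u) : Ω → ℝ⁷`. -/
def Ufull (u : E3 → Fin 3 → ℝ) : E3 → Fin 7 → ℝ :=
  fun x => ![u x 0, u x 1, u x 2, divg u x, curl u x 0, curl u x 1, curl u x 2]

/-- The lower-order term `Σ_{|β|≤3} a_β ∂^β U`, component `i`. -/
def lowOrd (aβ : (Fin 3 → ℕ) → E3 → Fin 7 → Fin 7 → ℝ) (U : E3 → Fin 7 → ℝ)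
    (x : E3) (i : Fin 7) : ℝ :=
  ∑ β ∈ Finset.univ.filter (fun β : Fin 3 → Fin 4 => mdeg (fun k => (β k : ℕ)) ≤ 3),
    ∑ j, aβ (fun k => (β k : ℕ)) x i j * mpd (fun k => (β k : ℕ)) (fun y => U y j) x


/-- The operator `Σ_{j,k} a_jk(x) ∂²_{jk}` acting componentwise on `ℝ⁷`-valued maps. -/
def op2V (a : Fin 3 → Fin 3 → E3 → ℝ) (V : E3 → E7) : E3 → E7 :=
  fun x => (WithLp.equiv 2 (Fin 7 → ℝ)).symm fun i => op2 a (fun y => V y i) x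

/-- A smooth function whose support is a compact subset of `U`. -/
structure IsTest (U : Set E3) (f : E3 → ℝ) : Prop where
  contDiff : ContDiff ℝ (⊤ : ℕ∞) f
  hasCompactSupport : HasCompactSupport f
  tsupport_subset : tsupport f ⊆ U

section PartialDerivatives

variable {U : Set E3} {f g : E3 → ℝ} {x : E3}

lemma ContDiffOn.differentiableAt_of_isOpen (hU : IsOpen U) (hf : ContDiffOn ℝ (⊤ : ℕ∞) f U)
    (hx : x ∈ U) : DifferentiableAt ℝ f x :=
  (hf.contDiffAt (hU.mem_nhds hx)).differentiableAt (by simp)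

lemma ContDiffOn.pd (hU : IsOpen U) (hf : ContDiffOn ℝ (⊤ : ℕ∞) f U) (i : Fin 3) :
    ContDiffOn ℝ (⊤ : ℕ∞) (pd i f) U :=
  (hf.fderiv_of_isOpen (m := (⊤ : ℕ∞)) hU (by simp)).clm_apply contDiffOn_const

lemma pd_mul (i : Fin 3) (hf : DifferentiableAt ℝ f x) (hg : DifferentiableAt ℝ g x) :
    pd i (fun y => f y * g y) x = pd i f x * g x + f x * pd i g x := by
  simp only [pd]
  rw [fderiv_fun_mul hf hg]
  simp
  ring

lemma pd_add (i : Fin 3) (hf : DifferentiableAt ℝ f x) (hg : DifferentiableAt ℝ g x) :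
    pd i (fun y => f y + g y) x = pd i f x + pd i g x := by
  simp only [pd]
  rw [fderiv_fun_add hf hg]
  simp

lemma pd_sub (i : Fin 3) (hf : DifferentiableAt ℝ f x) (hg : DifferentiableAt ℝ g x) :
    pd i (fun y => f y - g y) x = pd i f x - pd i g x := by
  simp only [pd]
  rw [fderiv_fun_sub hf hg]
  simp

lemma pd_neg (i : Fin 3) : pd i (fun y => -f y) x = -pd i f x := by
  simp [pd, fderiv_fun_neg]

lemma pd_const (i : Fin 3) (c : ℝ) : pd i (fun _ => c) x = 0 := by
  simp [pd]

lemma pd_const_mul (i : Fin 3) (c : ℝ) (hf : DifferentiableAt ℝ f x) :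
    pd i (fun y => c * f y) x = c * pd i f x := by
  rw [pd_mul i (differentiableAt_const c) hf, pd_const]
  ring

lemma pd_sum {ι : Type*} (s : Finset ι) (F : ι → E3 → ℝ) (i : Fin 3)
    (hF : ∀ j ∈ s, DifferentiableAt ℝ (F j) x) :
    pd i (fun y => ∑ j ∈ s, F j y) x = ∑ j ∈ s, pd i (F j) x := by
  simp only [pd]
  rw [fderiv_fun_sum hF]
  simp

lemma pd_coord (i j : Fin 3) : pd i (fun y => y j) x = if i = j then 1 else 0 := by
  have h : (fun y : E3 => y j) = (EuclideanSpace.proj j : E3 →L[ℝ] ℝ) := rfl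
  rw [pd, h, ContinuousLinearMap.fderiv]
  simp [eq_comm]

lemma contDiffOn_coord (j : Fin 3) : ContDiffOn ℝ (⊤ : ℕ∞) (fun y : E3 => y j) U :=
  (EuclideanSpace.proj j : E3 →L[ℝ] ℝ).contDiff.contDiffOn

lemma Filter.EventuallyEq.pd_eq (i : Fin 3) (h : f =ᶠ[nhds x] g) : pd i f x = pd i g x := by
  simp only [pd]
  rw [h.fderiv_eq]

lemma pd_comm (i j : Fin 3) (hU : IsOpen U) (hf : ContDiffOn ℝ (⊤ : ℕ∞) f U) (hx : x ∈ U) :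
    pd i (pd j f) x = pd j (pd i f) x := by
  have h2 : ContDiffAt ℝ (⊤ : ℕ∞) f x := hf.contDiffAt (hU.mem_nhds hx)
  have hd : DifferentiableAt ℝ (fderiv ℝ f) x :=
    (h2.fderiv_right (m := (⊤ : ℕ∞)) (by simp)).differentiableAt (by simp)
  have hs := h2.isSymmSndFDerivAt (by
    simp only [minSmoothness_of_isRCLikeNormedField]
    exact WithTop.coe_le_coe.2 (le_top : (2 : ℕ∞) ≤ ⊤))
  have key : ∀ v w : E3, fderiv ℝ (fun y => fderiv ℝ f y v) x w = fderiv ℝ (fderiv ℝ f) x w v := by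
    intro v w
    rw [fderiv_clm_apply hd (differentiableAt_const v)]
    simp
  change fderiv ℝ (fun y => fderiv ℝ f y _) x _ = fderiv ℝ (fun y => fderiv ℝ f y _) x _
  rw [key, key, hs]

end PartialDerivatives

namespace IsTest

variable {U : Set E3} {f g c : E3 → ℝ} {x : E3}

lemma contDiffOn (hf : IsTest U f) : ContDiffOn ℝ (⊤ : ℕ∞) f U := hf.contDiff.contDiffOn

lemma differentiableAt (hf : IsTest U f) : DifferentiableAt ℝ f x :=
  hf.contDiff.differentiable (by simp) x

lemma eventuallyEq_zero (hf : IsTest U f) (hx : x ∉ U) : f =ᶠ[nhds x] 0 :=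
  notMem_tsupport_iff_eventuallyEq.1 fun h => hx (hf.tsupport_subset h)

lemma eq_zero (hf : IsTest U f) (hx : x ∉ U) : f x = 0 := (hf.eventuallyEq_zero hx).eq_of_nhds

lemma pd (hf : IsTest U f) (i : Fin 3) : IsTest U (pd i f) where
  contDiff := contDiffOn_univ.1 (hf.contDiff.contDiffOn.pd isOpen_univ i)
  hasCompactSupport := hf.hasCompactSupport.fderiv_apply ℝ _
  tsupport_subset := (tsupport_fderiv_apply_subset ℝ _).trans hf.tsupport_subset

lemma pd_comm (hf : IsTest U f) (i j : Fin 3) : _root_.pd i (_root_.pd j f) x =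
    _root_.pd j (_root_.pd i f) x :=
  _root_.pd_comm i j isOpen_univ hf.contDiff.contDiffOn (Set.mem_univ x)

lemma coef_mul (hU : IsOpen U) (hc : ContDiffOn ℝ (⊤ : ℕ∞) c U) (hf : IsTest U f) :
    IsTest U (fun x => c x * f x) := by
  have hsub : tsupport (fun x => c x * f x) ⊆ tsupport f := tsupport_mul_subset_right
  refine ⟨?_, hf.hasCompactSupport.mul_left, hsub.trans hf.tsupport_subset⟩
  rw [contDiff_iff_contDiffAt]
  intro x
  by_cases hx : x ∈ U
  · exact (hc.contDiffAt (hU.mem_nhds hx)).mul hf.contDiff.contDiffAt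
  · have h0 : (fun x => c x * f x) =ᶠ[nhds x] fun _ => 0 := by
      filter_upwards [hf.eventuallyEq_zero hx] with y hy
      simp [hy]
    exact contDiffAt_const.congr_of_eventuallyEq h0

lemma mul (hU : IsOpen U) (hf : IsTest U f) (hg : IsTest U g) : IsTest U (fun x => f x * g x) :=
  coef_mul hU hf.contDiffOn hg

lemma add (hf : IsTest U f) (hg : IsTest U g) : IsTest U (fun x => f x + g x) where
  contDiff := hf.contDiff.add hg.contDiff
  hasCompactSupport := hf.hasCompactSupport.add hg.hasCompactSupport
  tsupport_subset := (tsupport_add f g).trans (Set.union_subset hf.tsupport_subset hg.tsupport_subset)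

lemma const_mul (hU : IsOpen U) (a : ℝ) (hf : IsTest U f) : IsTest U (fun x => a * f x) :=
  coef_mul hU contDiffOn_const hf

lemma sub (hU : IsOpen U) (hf : IsTest U f) (hg : IsTest U g) : IsTest U (fun x => f x - g x) := by
  simpa [sub_eq_add_neg] using hf.add (hg.const_mul hU (-1))

lemma zero : IsTest U (fun _ => 0) where
  contDiff := contDiff_const
  hasCompactSupport := HasCompactSupport.zero
  tsupport_subset := by
    have : tsupport (fun _ : E3 => (0 : ℝ)) = ∅ := tsupport_eq_empty_iff.2 rfl
    simp [this]

lemma sum {ι : Type*} (s : Finset ι) {F : ι → E3 → ℝ} (hF : ∀ i ∈ s, IsTest U (F i)) :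
    IsTest U (fun x => ∑ i ∈ s, F i x) := by
  classical
  induction s using Finset.induction_on with
  | empty => simpa using zero
  | insert a s ha ih =>
    simp only [Finset.sum_insert ha]
    exact (hF a (by simp)).add (ih fun i hi => hF i (by simp [hi]))

lemma sq (hU : IsOpen U) (hf : IsTest U f) : IsTest U (fun x => f x ^ 2) := by
  simpa [pow_two] using hf.mul hU hf

lemma integrable (hf : IsTest U f) : Integrable f :=
  hf.contDiff.continuous.integrable_of_hasCompactSupport hf.hasCompactSupport

lemma integral_pd (hf : IsTest U f) (i : Fin 3) : ∫ x, _root_.pd i f x = 0 := by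
  have h := integral_bilinear_fderiv_right_eq_neg_left_of_integrable (μ := (volume : Measure E3))
    (f := fun _ : E3 => (1 : ℝ)) (g := f) (v := EuclideanSpace.single i 1)
    (B := ContinuousLinearMap.mul ℝ ℝ) (by simp)
    (by simp only [ContinuousLinearMap.mul_apply', one_mul]; exact (hf.pd i).integrable)
    (by simpa using hf.integrable) (fun x _ => differentiableAt_const _)
    (fun x _ => hf.differentiableAt)
  simpa [_root_.pd] using h

lemma op2 (hU : IsOpen U) {a : Fin 3 → Fin 3 → E3 → ℝ}
    (ha : ∀ j k, ContDiffOn ℝ (⊤ : ℕ∞) (a j k) U) (hf : IsTest U f) : IsTest U (op2 a f) :=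
  sum _ fun j _ => sum _ fun k _ => coef_mul hU (ha j k) ((hf.pd k).pd j)

end IsTest

/-- The expanded `i`-th partial derivative of a product `c * f * g`. -/
def pdMul3 (i : Fin 3) (c f g : E3 → ℝ) (x : E3) : ℝ :=
  pd i c x * f x * g x + c x * pd i f x * g x + c x * f x * pd i g x

section DivergenceTerms

variable {U : Set E3} {f g c : E3 → ℝ}

lemma isTest_pdMul3 (hU : IsOpen U) (i : Fin 3) (hc : ContDiffOn ℝ (⊤ : ℕ∞) c U) (hf : IsTest U f)
    (hg : IsTest U g) : IsTest U (pdMul3 i c f g) :=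
  (((hf.coef_mul hU (hc.pd hU i)).mul hU hg).add (((hf.pd i).coef_mul hU hc).mul hU hg)).add
    ((hf.coef_mul hU hc).mul hU (hg.pd i))

lemma integral_pdMul3 (hU : IsOpen U) (i : Fin 3) (hc : ContDiffOn ℝ (⊤ : ℕ∞) c U)
    (hf : IsTest U f) (hg : IsTest U g) : ∫ x, pdMul3 i c f g x = 0 := by
  have ht := (hf.coef_mul hU hc).mul hU hg
  rw [← ht.integral_pd i]
  congr 1
  ext x
  by_cases hx : x ∈ U
  · have hcx := hc.differentiableAt_of_isOpen hU hx
    rw [pd_mul i (f := fun y => c y * f y) (hcx.mul hf.differentiableAt) hg.differentiableAt,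
      pd_mul i hcx hf.differentiableAt, pdMul3]
    ring
  · rw [(ht.pd i).eq_zero hx, (isTest_pdMul3 hU i hc hf hg).eq_zero hx]

/-- Comparison of integrals of test functions up to a null-integral term. -/
lemma integral_le_of_le_add {F G D : E3 → ℝ} (hF : IsTest U F) (hG : IsTest U G) (hD : IsTest U D)
    (hD0 : ∫ x, D x = 0) (h : ∀ x ∈ U, F x ≤ G x + D x) : ∫ x, F x ≤ ∫ x, G x := by
  have h1 : ∫ x, F x ≤ ∫ x, (G x + D x) := by
    refine integral_mono hF.integrable (hG.integrable.add hD.integrable) fun x => ?_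
    by_cases hx : x ∈ U
    · exact h x hx
    · simp [hF.eq_zero hx, hG.eq_zero hx, hD.eq_zero hx]
  rwa [integral_add hG.integrable hD.integrable, hD0, add_zero] at h1

lemma integral_le_of_le {F G : E3 → ℝ} (hF : IsTest U F) (hG : IsTest U G)
    (h : ∀ x ∈ U, F x ≤ G x) : ∫ x, F x ≤ ∫ x, G x :=
  integral_le_of_le_add hF hG IsTest.zero (by simp) fun x hx => by simpa using h x hx

end DivergenceTerms

/-- The sum of the squares of all iterated partial derivatives of order `n`. -/
def sqJet : ℕ → (E3 → ℝ) → E3 → ℝ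
  | 0, f => fun x => f x ^ 2
  | n + 1, f => fun x => ∑ i, sqJet n (pd i f) x

lemma sqJet_nonneg (n : ℕ) (f : E3 → ℝ) (x : E3) : 0 ≤ sqJet n f x := by
  induction n generalizing f with
  | zero => exact sq_nonneg _
  | succ n ih => exact sum_nonneg fun i _ => ih _

lemma IsTest.sqJet {U : Set E3} (hU : IsOpen U) {f : E3 → ℝ} (hf : IsTest U f) (n : ℕ) :
    IsTest U (sqJet n f) := by
  induction n generalizing f with
  | zero => exact hf.sq hU
  | succ n ih => exact IsTest.sum _ fun i _ => ih (hf.pd i)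

lemma sqJet_pd_le (n : ℕ) (f : E3 → ℝ) (i : Fin 3) (x : E3) :
    sqJet n (pd i f) x ≤ sqJet (n + 1) f x :=
  single_le_sum (f := fun i => sqJet n (pd i f) x) (fun _ _ => sqJet_nonneg _ _ _) (mem_univ i)

lemma sq_pd_le (f : E3 → ℝ) (i : Fin 3) (x : E3) : pd i f x ^ 2 ≤ sqJet 1 f x :=
  sqJet_pd_le 0 f i x

lemma sq_pd_pd_le (f : E3 → ℝ) (i j : Fin 3) (x : E3) : pd i (pd j f) x ^ 2 ≤ sqJet 2 f x :=
  (sq_pd_le _ i x).trans (sqJet_pd_le 1 f j x)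

/-- Symmetric elliptic coefficients on `U` with quantitative bounds. -/
structure EllipticCoef (U : Set E3) (a : Fin 3 → Fin 3 → E3 → ℝ) (c0 M : ℝ) : Prop where
  smooth : ∀ j k, ContDiffOn ℝ (⊤ : ℕ∞) (a j k) U
  symm : ∀ j k x, a j k x = a k j x
  elliptic : ∀ x ∈ U, ∀ ξ : Fin 3 → ℝ, c0 * (∑ i, ξ i ^ 2) ≤ ∑ j, ∑ k, a j k x * ξ j * ξ k
  bound : ∀ j k, ∀ x ∈ U, |a j k x| ≤ M
  bound_pd : ∀ i j k, ∀ x ∈ U, |pd i (a j k) x| ≤ M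
  bound_pd_pd : ∀ i l j k, ∀ x ∈ U, |pd i (pd l (a j k)) x| ≤ M

lemma exists_sum_mul_of_elliptic {c0 : ℝ} (hc0 : 0 < c0) {A : Fin 3 → Fin 3 → ℝ}
    (hA : ∀ j k, A j k = A k j)
    (hell : ∀ ξ : Fin 3 → ℝ, c0 * (∑ i, ξ i ^ 2) ≤ ∑ j, ∑ k, A j k * ξ j * ξ k) :
    ∃ (m : ℕ) (B : Fin m → Fin 3 → ℝ), ∀ j k, A j k = ∑ i, B i j * B i k := by
  have hpsd : (Matrix.of A).PosSemidef := by
    rw [Matrix.posSemidef_iff_dotProduct_mulVec]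
    refine ⟨?_, fun ξ => ?_⟩
    · ext j k
      simp [hA j k]
    · have h := hell ξ
      have h2 : 0 ≤ c0 * (∑ i, ξ i ^ 2) := by positivity
      refine (h2.trans h).trans (le_of_eq ?_)
      simp only [dotProduct, Matrix.mulVec, Matrix.of_apply, star_trivial, mul_sum]
      exact sum_congr rfl fun j _ => sum_congr rfl fun k _ => by ring
  obtain ⟨m, v, hv⟩ := Matrix.posSemidef_iff_eq_sum_vecMulVec.1 hpsd
  refine ⟨m, v, fun j k => ?_⟩
  have := congrFun (congrFun hv j) k
  simpa [Matrix.sum_apply, Matrix.vecMulVec_apply] using this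

/-- `tr (A H A H) ≥ c₀² |H|²` for symmetric `H` and symmetric `A ≥ c₀`. -/
lemma sq_mul_sum_sq_le_trace {c0 : ℝ} (hc0 : 0 < c0) {A H : Fin 3 → Fin 3 → ℝ}
    (hA : ∀ j k, A j k = A k j) (hH : ∀ j k, H j k = H k j)
    (hell : ∀ ξ : Fin 3 → ℝ, c0 * (∑ i, ξ i ^ 2) ≤ ∑ j, ∑ k, A j k * ξ j * ξ k) :
    c0 ^ 2 * ∑ i, ∑ j, H i j ^ 2 ≤
      ∑ j, ∑ k, ∑ l, ∑ m, A j k * A l m * (H l k * H j m) := by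
  obtain ⟨n, B, hB⟩ := exists_sum_mul_of_elliptic hc0 hA hell
  have e1 : ∑ j, ∑ k, ∑ l, ∑ m, A j k * A l m * (H l k * H j m) =
      ∑ i, ∑ l, ∑ m, A l m * (∑ k, B i k * H l k) * (∑ k, B i k * H m k) := by
    have : ∀ j k l m, A j k * A l m * (H l k * H j m) =
        ∑ i, A l m * (B i k * H l k) * (B i j * H m j) := by
      intro j k l m
      rw [hB j k, sum_mul, sum_mul, hH j m]
      exact sum_congr rfl fun i _ => by ring
    simp only [this]
    simp only [Fin.sum_univ_three, ← sum_add_distrib]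
    exact sum_congr rfl fun i _ => by ring
  have e2 : ∑ i, ∑ l, (∑ k, B i k * H l k) ^ 2 = ∑ l, ∑ j, ∑ k, A j k * H l j * H l k := by
    simp only [hB]
    simp only [Fin.sum_univ_three, ← sum_add_distrib, sum_mul]
    exact sum_congr rfl fun i _ => by ring
  have h1 : c0 * ∑ i, ∑ l, (∑ k, B i k * H l k) ^ 2 ≤
      ∑ i, ∑ l, ∑ m, A l m * (∑ k, B i k * H l k) * (∑ k, B i k * H m k) := by
    rw [mul_sum]
    exact sum_le_sum fun i _ => hell fun l => ∑ k, B i k * H l k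
  have h2 : c0 * ∑ l, ∑ j, H l j ^ 2 ≤ ∑ l, ∑ j, ∑ k, A j k * H l j * H l k := by
    rw [mul_sum]
    exact sum_le_sum fun l _ => hell (H l)
  rw [e1]
  refine le_trans ?_ h1
  rw [e2, pow_two, mul_assoc]
  exact mul_le_mul_of_nonneg_left h2 hc0.le

lemma mul_mul_le_weighted {w B N W p q P Q ε : ℝ} (hε : 0 < ε) (hW : 0 ≤ W)
    (hw : |w| ≤ B * N * W) (hp : p ^ 2 ≤ P) (hq : q ^ 2 ≤ Q) :
    w * p * q ≤ W * (ε * Q + B ^ 2 / (4 * ε) * N ^ 2 * P) := by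
  have h1 : w * p * q ≤ B * N * W * (|p| * |q|) := by
    calc w * p * q ≤ |w * p * q| := le_abs_self _
      _ = |w| * (|p| * |q|) := by rw [abs_mul, abs_mul]; ring
      _ ≤ _ := by gcongr
  have h2 : B * N * (|p| * |q|) ≤ ε * |q| ^ 2 + B ^ 2 / (4 * ε) * N ^ 2 * |p| ^ 2 := by
    have h3 : 0 ≤ (2 * ε * |q| - B * N * |p|) ^ 2 / (4 * ε) := by positivity
    have h4 : (2 * ε * |q| - B * N * |p|) ^ 2 / (4 * ε) =
        ε * |q| ^ 2 + B ^ 2 / (4 * ε) * N ^ 2 * |p| ^ 2 - B * N * (|p| * |q|) := by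
      field_simp
      ring
    linarith
  rw [sq_abs, sq_abs] at h2
  calc w * p * q ≤ W * (B * N * (|p| * |q|)) := by linarith
    _ ≤ W * (ε * q ^ 2 + B ^ 2 / (4 * ε) * N ^ 2 * p ^ 2) := by gcongr
    _ ≤ _ := by gcongr

section Elliptic

variable {U : Set E3} {a : Fin 3 → Fin 3 → E3 → ℝ} {c0 M : ℝ} {W N : E3 → ℝ}

lemma EllipticCoef.abs_pd_weight_mul_mul_le (hU : IsOpen U) (ha : EllipticCoef U a c0 M)
    (hW : ContDiffOn ℝ (⊤ : ℕ∞) W U) {x : E3} (hx : x ∈ U) (hWpos : 0 < W x) (hN : 1 ≤ N x)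
    (hWN : ∀ i, |pd i W x| ≤ N x * W x) (i j k l m : Fin 3) :
    |pd i (fun y => W y * (a j k y * a l m y)) x| ≤ 3 * M ^ 2 * N x * W x := by
  have d1 := (ha.smooth j k).differentiableAt_of_isOpen hU hx
  have d2 := (ha.smooth l m).differentiableAt_of_isOpen hU hx
  have d3 := hW.differentiableAt_of_isOpen hU hx
  rw [pd_mul i (g := fun y => a j k y * a l m y) d3 (d1.mul d2), pd_mul i d1 d2]
  have hM : 0 ≤ M := (abs_nonneg _).trans (ha.bound j k x hx)
  have b1 : |pd i W x * (a j k x * a l m x)| ≤ N x * W x * (M * M) := by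
    rw [abs_mul, abs_mul]
    gcongr
    exacts [hWN i, ha.bound j k x hx, ha.bound l m x hx]
  have b2 : |W x * (pd i (a j k) x * a l m x)| ≤ N x * W x * (M * M) := by
    rw [abs_mul, abs_mul, abs_of_pos hWpos]
    have : W x ≤ N x * W x := by nlinarith
    gcongr
    exacts [ha.bound_pd i j k x hx, ha.bound l m x hx]
  have b3 : |W x * (a j k x * pd i (a l m) x)| ≤ N x * W x * (M * M) := by
    rw [abs_mul, abs_mul, abs_of_pos hWpos]
    have : W x ≤ N x * W x := by nlinarith
    gcongr
    exacts [ha.bound j k x hx, ha.bound_pd i l m x hx]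
  calc _ = |pd i W x * (a j k x * a l m x) + W x * (pd i (a j k) x * a l m x) +
        W x * (a j k x * pd i (a l m) x)| := by congr 1; ring
    _ ≤ _ := abs_add_three _ _ _
    _ ≤ _ := by linarith

/-- The constant in the weighted `H²` estimate. -/
def ellipticConst (c0 M : ℝ) : ℝ :=
  2 / c0 ^ 2 * (1 + 162 * ((3 * M ^ 2) ^ 2 / (4 * (c0 ^ 2 / 324))))

lemma ellipticConst_pos (hc0 : 0 < c0) : 0 < ellipticConst c0 M := by
  unfold ellipticConst
  positivity

/-- Weighted `H²` estimate for a nondivergence form elliptic operator. -/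
lemma EllipticCoef.integral_sqJet_two_le (hU : IsOpen U) (hc0 : 0 < c0)
    (ha : EllipticCoef U a c0 M) (hW : ContDiffOn ℝ (⊤ : ℕ∞) W U)
    (hN : ContDiffOn ℝ (⊤ : ℕ∞) N U) (hWpos : ∀ x ∈ U, 0 < W x) (hN1 : ∀ x ∈ U, 1 ≤ N x)
    (hWN : ∀ i, ∀ x ∈ U, |pd i W x| ≤ N x * W x) {u : E3 → ℝ} (hu : IsTest U u) :
    ∫ x, W x * sqJet 2 u x ≤ ellipticConst c0 M *
      ((∫ x, W x * op2 a u x ^ 2) + ∫ x, N x ^ 2 * W x * sqJet 1 u x) := by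
  have hw : ∀ j k l m, ContDiffOn ℝ (⊤ : ℕ∞) (fun y => W y * (a j k y * a l m y)) U :=
    fun j k l m => hW.mul ((ha.smooth j k).mul (ha.smooth l m))
  have tD : ∀ j k l m, IsTest U fun x =>
      pdMul3 l (fun y => W y * (a j k y * a l m y)) (pd k u) (pd j (pd m u)) x -
      pdMul3 j (fun y => W y * (a j k y * a l m y)) (pd k u) (pd l (pd m u)) x := fun j k l m =>
    (isTest_pdMul3 hU l (hw j k l m) (hu.pd k) ((hu.pd m).pd j)).sub hU
      (isTest_pdMul3 hU j (hw j k l m) (hu.pd k) ((hu.pd m).pd l))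
  have tP : IsTest U fun x => W x * op2 a u x ^ 2 := ((hu.op2 hU ha.smooth).sq hU).coef_mul hU hW
  have tS1 : IsTest U fun x => N x ^ 2 * W x * sqJet 1 u x :=
    (hu.sqJet hU 1).coef_mul hU ((hN.pow 2).mul hW)
  have tS2 : IsTest U fun x => W x * sqJet 2 u x := (hu.sqJet hU 2).coef_mul hU hW
  rw [← integral_add tP.integrable tS1.integrable, ← integral_const_mul]
  refine integral_le_of_le_add (D := fun x => 2 / c0 ^ 2 * ∑ j, ∑ k, ∑ l, ∑ m,
      (pdMul3 l (fun y => W y * (a j k y * a l m y)) (pd k u) (pd j (pd m u)) x -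
      pdMul3 j (fun y => W y * (a j k y * a l m y)) (pd k u) (pd l (pd m u)) x)) tS2
    ((tP.add tS1).const_mul hU _) ?_ ?_ ?_
  · exact IsTest.const_mul hU _ <| IsTest.sum _ fun j _ => IsTest.sum _ fun k _ =>
      IsTest.sum _ fun l _ => IsTest.sum _ fun m _ => tD j k l m
  · rw [integral_const_mul]
    have i0 : ∀ j k l m, ∫ x,
        (pdMul3 l (fun y => W y * (a j k y * a l m y)) (pd k u) (pd j (pd m u)) x -
        pdMul3 j (fun y => W y * (a j k y * a l m y)) (pd k u) (pd l (pd m u)) x) = 0 := by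
      intro j k l m
      rw [integral_sub, integral_pdMul3 hU l (hw j k l m) (hu.pd k) ((hu.pd m).pd j),
        integral_pdMul3 hU j (hw j k l m) (hu.pd k) ((hu.pd m).pd l), sub_zero]
      · exact (isTest_pdMul3 hU l (hw j k l m) (hu.pd k) ((hu.pd m).pd j)).integrable
      · exact (isTest_pdMul3 hU j (hw j k l m) (hu.pd k) ((hu.pd m).pd l)).integrable
    rw [integral_finsetSum, sum_eq_zero, mul_zero]
    · intro j _
      rw [integral_finsetSum, sum_eq_zero]
      · intro k _
        rw [integral_finsetSum, sum_eq_zero]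
        · intro l _
          rw [integral_finsetSum, sum_eq_zero]
          · exact fun m _ => i0 j k l m
          · exact fun m _ => (tD j k l m).integrable
        · exact fun l _ => (IsTest.sum _ fun m _ => tD j k l m).integrable
      · exact fun k _ => (IsTest.sum _ fun l _ => IsTest.sum _ fun m _ => tD j k l m).integrable
    · exact fun j _ => (IsTest.sum _ fun k _ => IsTest.sum _ fun l _ =>
        IsTest.sum _ fun m _ => tD j k l m).integrable
  · intro x hx
    have hS1 := sqJet_nonneg 1 u x
    have hS2 := sqJet_nonneg 2 u x
    have hWx := hWpos x hx
    have htr := sq_mul_sum_sq_le_trace hc0 (A := fun j k => a j k x)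
      (H := fun j k => pd k (pd j u) x) (fun j k => ha.symm j k x) (fun j k => hu.pd_comm k j)
      (ha.elliptic x hx)
    have hS2' : sqJet 2 u x = ∑ i, ∑ j, pd j (pd i u) x ^ 2 := rfl
    rw [← hS2'] at htr
    set ε : ℝ := c0 ^ 2 / 324 with hε
    have hεpos : 0 < ε := by positivity
    set T : ℝ := W x * (ε * sqJet 2 u x + (3 * M ^ 2) ^ 2 / (4 * ε) * N x ^ 2 * sqJet 1 u x)
      with hT
    have hterm : ∀ j k l m, W x * (a j k x * a l m x * (pd k (pd l u) x * pd m (pd j u) x)) ≤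
        W x * (a j k x * pd j (pd k u) x) * (a l m x * pd l (pd m u) x) + 2 * T +
        (pdMul3 l (fun y => W y * (a j k y * a l m y)) (pd k u) (pd j (pd m u)) x -
        pdMul3 j (fun y => W y * (a j k y * a l m y)) (pd k u) (pd l (pd m u)) x) := by
      intro j k l m
      have c1 : pd l (pd j (pd m u)) x = pd j (pd l (pd m u)) x := (hu.pd m).pd_comm l j
      have c2 : pd l (pd k u) x = pd k (pd l u) x := hu.pd_comm l k
      have c3 : pd m (pd j u) x = pd j (pd m u) x := hu.pd_comm m j
      have hb := fun i => ha.abs_pd_weight_mul_mul_le (N := N) hU hW hx hWx (hN1 x hx)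
        (fun i => hWN i x hx) i j k l m
      have t1 := mul_mul_le_weighted hεpos hWx.le (hb j) (sq_pd_le u k x) (sq_pd_pd_le u l m x)
      have t2 := mul_mul_le_weighted hεpos hWx.le (w := -pd l _ x)
        (by rw [abs_neg]; exact hb l) (sq_pd_le u k x) (sq_pd_pd_le u j m x)
      rw [← hT] at t1 t2
      simp only [pdMul3, c1, c2, c3]
      linarith
    have hsum := sum_le_sum fun j (_ : j ∈ univ) => sum_le_sum fun k (_ : k ∈ univ) =>
      sum_le_sum fun l (_ : l ∈ univ) => sum_le_sum fun m (_ : m ∈ univ) => hterm j k l m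
    simp only [← mul_sum, sum_add_distrib, ← sum_mul, sum_const, card_univ, Fintype.card_fin,
      nsmul_eq_mul] at hsum
    have hP : op2 a u x = ∑ j, ∑ k, a j k x * pd j (pd k u) x := rfl
    rw [← hP] at hsum
    generalize (∑ j, ∑ k, ∑ l, ∑ m,
      (pdMul3 l (fun y => W y * (a j k y * a l m y)) (pd k u) (pd j (pd m u)) x -
      pdMul3 j (fun y => W y * (a j k y * a l m y)) (pd k u) (pd l (pd m u)) x)) = D at hsum ⊢
    have h1 := hsum.trans' (mul_le_mul_of_nonneg_left htr hWx.le)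
    set K : ℝ := (3 * M ^ 2) ^ 2 / (4 * ε) with hK
    have hKpos : 0 ≤ K := by positivity
    have hP0 : 0 ≤ W x * op2 a u x ^ 2 := by positivity
    have hN0 : 0 ≤ N x ^ 2 * W x * sqJet 1 u x := by positivity
    have hKP := mul_nonneg hKpos hP0
    have h2 : c0 ^ 2 / 2 * (W x * sqJet 2 u x) ≤
        (1 + 162 * K) * (W x * op2 a u x ^ 2 + N x ^ 2 * W x * sqJet 1 u x) + D := by
      push_cast at h1
      linear_combination h1 + 162 * hT + (162 * W x * sqJet 2 u x) * hε + hN0 + 162 * hKP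
    calc W x * sqJet 2 u x = 2 / c0 ^ 2 * (c0 ^ 2 / 2 * (W x * sqJet 2 u x)) := by
          field_simp
      _ ≤ 2 / c0 ^ 2 * ((1 + 162 * K) *
          (W x * op2 a u x ^ 2 + N x ^ 2 * W x * sqJet 1 u x) + D) := by gcongr
      _ = _ := by rw [ellipticConst, hK, hε]; ring

end Elliptic

section Spectral

/-- Spectral consequences of the eigenvalue gap condition, in terms of the extreme eigenvalues. -/
lemma exists_spectral_bounds {a : Fin 3 → Fin 3 → E3 → ℝ} {α c0 : ℝ} (hc0 : 0 < c0)
    (hsym : ∀ j k, a j k 0 = a k j 0)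
    (hell : ∀ ξ : Fin 3 → ℝ, c0 * (∑ i, ξ i ^ 2) ≤ ∑ j, ∑ k, a j k 0 * ξ j * ξ k)
    (heig : EigCond a α) :
    ∃ l1 l3 : ℝ, 0 < l1 ∧ 0 < l3 ∧ l3 < (1 + α) * l1 ∧ ∀ ξ : Fin 3 → ℝ,
      l1 * (∑ i, ξ i ^ 2) ≤ ∑ j, ∑ k, a j k 0 * ξ j * ξ k ∧
      ∑ j, (∑ k, a j k 0 * ξ k) ^ 2 ≤ l3 * ∑ j, ∑ k, a j k 0 * ξ j * ξ k ∧
      ∑ j, (∑ k, a j k 0 * ξ k) ^ 2 ≤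
        (l1 + l3) * (∑ j, ∑ k, a j k 0 * ξ j * ξ k) - l1 * l3 * ∑ i, ξ i ^ 2 := by
  have hA : (coefMatrix a 0).IsHermitian := by
    ext j k
    simp [coefMatrix, hsym j k]
  set μ := hA.eigenvalues with hμ
  set b := hA.eigenvectorBasis with hb
  have hAb : ∀ i j, ∑ k, a j k 0 * b i k = μ i * b i j := by
    intro i j
    have := congrFun (hA.mulVec_eigenvectorBasis i) j
    simp only [Matrix.mulVec, dotProduct, coefMatrix, Matrix.of_apply, Pi.smul_apply,
      smul_eq_mul] at this
    exact this
  have hin : ∀ x y : E3, inner ℝ x y = ∑ i, x i * y i := by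
    intro x y
    simp [PiLp.inner_apply, mul_comm]
  have hc : ∀ (ξ : Fin 3 → ℝ) i, inner ℝ (b i) (WithLp.toLp 2 fun j => ∑ k, a j k 0 * ξ k) =
      μ i * inner ℝ (b i) (WithLp.toLp 2 ξ) := by
    intro ξ i
    rw [hin, hin, mul_sum]
    simp only [mul_sum]
    rw [sum_comm]
    refine sum_congr rfl fun k _ => ?_
    rw [← mul_assoc, ← hAb i k, sum_mul]
    exact sum_congr rfl fun j _ => by rw [hsym j k]; ring
  have e0 : ∀ ξ : Fin 3 → ℝ, ∑ i, ξ i ^ 2 = ∑ i, inner ℝ (b i) (WithLp.toLp 2 ξ) ^ 2 := by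
    intro ξ
    have := b.sum_inner_mul_inner (WithLp.toLp 2 ξ) (WithLp.toLp 2 ξ)
    rw [hin] at this
    simp only [← pow_two] at this
    rw [← this]
    exact sum_congr rfl fun i _ => by rw [real_inner_comm]; ring
  have e1 : ∀ ξ : Fin 3 → ℝ, ∑ j, ∑ k, a j k 0 * ξ j * ξ k =
      ∑ i, μ i * inner ℝ (b i) (WithLp.toLp 2 ξ) ^ 2 := by
    intro ξ
    have := b.sum_inner_mul_inner (WithLp.toLp 2 ξ) (WithLp.toLp 2 fun j => ∑ k, a j k 0 * ξ k)
    rw [hin] at this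
    simp only [mul_sum] at this
    calc _ = ∑ j, ∑ k, ξ j * (a j k 0 * ξ k) :=
          sum_congr rfl fun j _ => sum_congr rfl fun k _ => by ring
      _ = _ := this.symm
      _ = _ := sum_congr rfl fun i _ => by rw [hc, real_inner_comm]; ring
  have e2 : ∀ ξ : Fin 3 → ℝ, ∑ j, (∑ k, a j k 0 * ξ k) ^ 2 =
      ∑ i, μ i ^ 2 * inner ℝ (b i) (WithLp.toLp 2 ξ) ^ 2 := by
    intro ξ
    rw [e0]
    exact sum_congr rfl fun i _ => by rw [hc]; ring
  have hpos : ∀ i, 0 < μ i := by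
    intro i
    have h1 := hell (b i)
    have h2 : ∑ j, (b i) j ^ 2 = 1 := by
      have := b.norm_eq_one i
      rw [EuclideanSpace.norm_eq, Real.sqrt_eq_one] at this
      simpa using this
    have h3 : ∑ j, ∑ k, a j k 0 * b i j * b i k = μ i := by
      calc _ = ∑ j, b i j * ∑ k, a j k 0 * b i k := by
            simp only [mul_sum]
            exact sum_congr rfl fun j _ => sum_congr rfl fun k _ => by ring
        _ = μ i * ∑ j, (b i) j ^ 2 := by
            rw [mul_sum]
            exact sum_congr rfl fun j _ => by rw [hAb]; ring
        _ = _ := by rw [h2, mul_one]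
    rw [h2, h3] at h1
    linarith
  obtain ⟨i1, h1⟩ := Finite.exists_min μ
  obtain ⟨i3, h3⟩ := Finite.exists_max μ
  refine ⟨μ i1, μ i3, hpos _, hpos _, ?_, fun ξ => ⟨?_, ?_, ?_⟩⟩
  · have := heig hA i3 i1
    rw [div_lt_iff₀ (hpos i1)] at this
    linarith
  · rw [e0 ξ, e1 ξ, mul_sum]
    exact sum_le_sum fun i _ => mul_le_mul_of_nonneg_right (h1 i) (sq_nonneg _)
  · rw [e2 ξ, e1 ξ, mul_sum]
    refine sum_le_sum fun i _ => ?_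
    rw [← mul_assoc]
    refine mul_le_mul_of_nonneg_right ?_ (sq_nonneg _)
    nlinarith [h3 i, hpos i]
  · rw [e2 ξ, e1 ξ, e0 ξ, mul_sum, mul_sum, ← sum_sub_distrib]
    refine sum_le_sum fun i _ => ?_
    rw [← mul_assoc, ← sub_mul]
    refine mul_le_mul_of_nonneg_right ?_ (sq_nonneg _)
    nlinarith [mul_nonneg (sub_nonneg.2 (h1 i)) (sub_nonneg.2 (h3 i))]

end Spectral

section Form

/-- The quadratic form in `(u, ∇u) = (s, ξ)` produced by pairing `-A : D²u - q u` with the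
multiplier `2 β · ∇u + e u`. The arguments `dA`, `dβ`, `dq` are the first derivatives of the
corresponding coefficients, and `c` is the divergence of `e A`. -/
def carlemanForm (A : Fin 3 → Fin 3 → ℝ) (dA : Fin 3 → Fin 3 → Fin 3 → ℝ) (β : Fin 3 → ℝ)
    (dβ : Fin 3 → Fin 3 → ℝ) (q : ℝ) (dq : Fin 3 → ℝ) (e : ℝ) (c : Fin 3 → ℝ) (s : ℝ)
    (ξ : Fin 3 → ℝ) : ℝ :=
  2 * (∑ j, ∑ k, ∑ l, (dA j j k * β l + A j k * dβ j l) * (ξ k * ξ l))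
    - (∑ j, ∑ k, ∑ l, (dβ j j * A k l + β j * dA j k l) * (ξ k * ξ l))
    + (∑ j, (q * dβ j j + β j * dq j)) * s ^ 2 + (∑ k, c k * ξ k) * s
    + e * (∑ j, ∑ k, A j k * (ξ j * ξ k)) - q * e * s ^ 2

lemma carlemanForm_scale {k r : ℝ} (hk : k ≠ 0) (hr : r ≠ 0) (A : Fin 3 → Fin 3 → ℝ)
    (B : Fin 3 → Fin 3 → Fin 3 → ℝ) (β : Fin 3 → ℝ)
    (dβ : Fin 3 → Fin 3 → ℝ) (q : ℝ) (dq : Fin 3 → ℝ) (e : ℝ) (c : Fin 3 → ℝ) (s : ℝ)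
    (ξ : Fin 3 → ℝ) :
    carlemanForm A (fun i j l => B i j l / r) (fun l => k * r * β l) (fun j l => k * dβ j l)
      (k ^ 2 * r ^ 2 * q) (fun j => k ^ 2 * r * dq j) (k * e) (fun j => k ^ 2 * r * c j) s ξ =
    k * carlemanForm A B β dβ q dq e c (k * r * s) ξ := by
  have h1 : ∀ j l m, (B j j l / r * (k * r * β m) + A j l * (k * dβ j m)) * (ξ l * ξ m) =
      k * ((B j j l * β m + A j l * dβ j m) * (ξ l * ξ m)) := by
    intro j l m
    field_simp
  have h2 : ∀ j l m, (k * dβ j j * A l m + k * r * β j * (B j l m / r)) * (ξ l * ξ m) =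
      k * ((dβ j j * A l m + β j * B j l m) * (ξ l * ξ m)) := by
    intro j l m
    field_simp
  have h3 : ∀ j, k ^ 2 * r ^ 2 * q * (k * dβ j j) + k * r * β j * (k ^ 2 * r * dq j) =
      k ^ 3 * r ^ 2 * (q * dβ j j + β j * dq j) := fun j => by ring
  have h4 : ∀ j, k ^ 2 * r * c j * ξ j = k ^ 2 * r * (c j * ξ j) := fun j => by ring
  simp only [carlemanForm, h1, h2, h3, h4, ← mul_sum]
  ring

/-- The angular part of the zeroth order multiplier. -/
def angular (A0 : Fin 3 → Fin 3 → ℝ) (α g : ℝ) (ω : Fin 3 → ℝ) : ℝ :=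
  (α + 2) * (∑ j, ∑ k, A0 j k * ω j * ω k) - (∑ j, A0 j j) + g

/-- The normalized gradient of the zeroth order multiplier. -/
def angularGrad (A0 : Fin 3 → Fin 3 → ℝ) (α g h : ℝ) (ω : Fin 3 → ℝ) (j : Fin 3) : ℝ :=
  -(h * ω j * angular A0 α g ω) + (α + 2) *
    (2 * (∑ k, A0 j k * ω k) - 2 * ω j * (∑ l, ∑ m, A0 l m * ω l * ω m))

/-- The form `carlemanForm` for a radial weight, normalized to be scale invariant, corrected by the
square of the zeroth order error. -/
def scaledForm (A0 : Fin 3 → Fin 3 → ℝ) (α g : ℝ) (A : Fin 3 → Fin 3 → ℝ)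
    (B : Fin 3 → Fin 3 → Fin 3 → ℝ) (h δ : ℝ) (ω : Fin 3 → ℝ) (s : ℝ) (ξ : Fin 3 → ℝ) : ℝ :=
  carlemanForm A B (fun l => -∑ m, A l m * ω m)
    (fun j l => h * ω j * (∑ m, A l m * ω m) - A l j - ∑ m, B j l m * ω m)
    (∑ j, ∑ k, A j k * ω j * ω k)
    (fun j => -(2 * h * ω j * (∑ l, ∑ m, A l m * ω l * ω m)) + 2 * (∑ m, A j m * ω m) +
      ∑ l, ∑ m, B j l m * ω l * ω m)
    (angular A0 α g ω)
    (fun k => δ * ∑ j, (angularGrad A0 α g h ω j * A j k + angular A0 α g ω * B j j k)) s ξ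
  - 1 / 2 * δ * (angular A0 α g ω - (h * (∑ j, ∑ k, A j k * ω j * ω k) - ∑ j, A j j)) ^ 2 * s ^ 2

lemma scaledForm_limit (A0 : Fin 3 → Fin 3 → ℝ) (hA : ∀ j k, A0 j k = A0 k j) (α g : ℝ)
    (ω : Fin 3 → ℝ) (s : ℝ) (ξ : Fin 3 → ℝ) :
    scaledForm A0 α g A0 0 (α + 2) 0 ω s ξ =
      (2 * (α + 2) * (∑ j, ω j * (∑ m, A0 j m * ξ m)) ^ 2
        + g * (∑ j, ∑ k, A0 j k * ξ j * ξ k) - 2 * ∑ j, (∑ k, A0 j k * ξ k) ^ 2) +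
      s ^ 2 * (2 * (α + 2) * (∑ j, ∑ k, A0 j k * ω j * ω k) ^ 2 -
        2 * (∑ j, (∑ k, A0 j k * ω k) ^ 2) - g * ∑ j, ∑ k, A0 j k * ω j * ω k) := by
  simp only [scaledForm, carlemanForm, angular, Fin.sum_univ_three, Pi.zero_apply, hA 1 0, hA 2 0,
    hA 2 1]
  ring

end Form

section Positivity

lemma continuous_scaledForm (A0 : Fin 3 → Fin 3 → ℝ) (α g : ℝ) :
    Continuous fun p : ((Fin 3 → Fin 3 → ℝ) × (Fin 3 → Fin 3 → Fin 3 → ℝ) × ℝ × ℝ) ×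
      ((Fin 3 → ℝ) × ℝ × (Fin 3 → ℝ)) =>
      scaledForm A0 α g p.1.1 p.1.2.1 p.1.2.2.1 p.1.2.2.2 p.2.1 p.2.2.1 p.2.2.2 := by
  unfold scaledForm carlemanForm angularGrad angular
  fun_prop

lemma scaledForm_smul (A0 : Fin 3 → Fin 3 → ℝ) (α g : ℝ) (A : Fin 3 → Fin 3 → ℝ)
    (B : Fin 3 → Fin 3 → Fin 3 → ℝ) (h δ : ℝ) (ω : Fin 3 → ℝ) (t s : ℝ) (ξ : Fin 3 → ℝ) :
    scaledForm A0 α g A B h δ ω (t * s) (fun i => t * ξ i) =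
      t ^ 2 * scaledForm A0 α g A B h δ ω s ξ := by
  have h1 : ∀ (x : ℝ) (j k : Fin 3), x * (t * ξ j * (t * ξ k)) = t ^ 2 * (x * (ξ j * ξ k)) :=
    fun x j k => by ring
  have h2 : ∀ (x : ℝ) (j : Fin 3), x * (t * ξ j) = t * (x * ξ j) := fun x j => by ring
  simp only [scaledForm, carlemanForm, h1, ← mul_sum]
  simp only [h2, ← mul_sum]
  ring

lemma le_scaledForm_limit {A0 : Fin 3 → Fin 3 → ℝ} (hA : ∀ j k, A0 j k = A0 k j) {α l1 l3 κ : ℝ}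
    (hα : 0 < α) (h1 : 0 < l1) (h3 : 0 < l3) (hκ : 0 < κ) (hgap : (1 + α) * l1 = l3 + κ)
    (hspec : ∀ ξ : Fin 3 → ℝ,
      l1 * (∑ i, ξ i ^ 2) ≤ ∑ j, ∑ k, A0 j k * ξ j * ξ k ∧
      ∑ j, (∑ k, A0 j k * ξ k) ^ 2 ≤ l3 * ∑ j, ∑ k, A0 j k * ξ j * ξ k ∧
      ∑ j, (∑ k, A0 j k * ξ k) ^ 2 ≤
        (l1 + l3) * (∑ j, ∑ k, A0 j k * ξ j * ξ k) - l1 * l3 * ∑ i, ξ i ^ 2)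
    {ω : Fin 3 → ℝ} (hω : ∑ i, ω i ^ 2 = 1) (s : ℝ) (ξ : Fin 3 → ℝ) :
    κ * l1 * (s ^ 2 + ∑ i, ξ i ^ 2) ≤ scaledForm A0 α (2 * l3 + κ) A0 0 (α + 2) 0 ω s ξ := by
  rw [scaledForm_limit A0 hA]
  obtain ⟨a1, a2, -⟩ := hspec ξ
  obtain ⟨b1, -, b3⟩ := hspec ω
  rw [hω, mul_one] at b1 b3
  set Q := ∑ j, ∑ k, A0 j k * ω j * ω k
  set Y := ∑ j, (∑ k, A0 j k * ω k) ^ 2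
  set X := ∑ j, ∑ k, A0 j k * ξ j * ξ k
  have hX : κ * l1 * ∑ i, ξ i ^ 2 ≤ 2 * (α + 2) * (∑ j, ω j * (∑ m, A0 j m * ξ m)) ^ 2
      + (2 * l3 + κ) * X - 2 * ∑ j, (∑ k, A0 j k * ξ k) ^ 2 := by
    have : 0 ≤ 2 * (α + 2) * (∑ j, ω j * (∑ m, A0 j m * ξ m)) ^ 2 := by positivity
    have := mul_le_mul_of_nonneg_left a1 hκ.le
    linarith
  have hS : κ * l1 ≤ 2 * (α + 2) * Q ^ 2 - 2 * Y - (2 * l3 + κ) * Q := by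
    have e1 : l1 * (2 * (α + 2) * Q ^ 2 - 2 * ((l1 + l3) * Q - l1 * l3) - (2 * l3 + κ) * Q) =
        2 * ((Q - l1) * (l1 * (Q - l1) + l3 * (Q - l1) + l1 ^ 2))
        + κ * (2 * Q * (Q - l1)) + l1 * (κ * Q) := by
      linear_combination (2 * Q ^ 2) * hgap
    have hq : 0 ≤ Q - l1 := by linarith
    have hQ : 0 < Q := by linarith
    have p1 : 0 ≤ 2 * ((Q - l1) * (l1 * (Q - l1) + l3 * (Q - l1) + l1 ^ 2)) := by positivity
    have p2 : 0 ≤ κ * (2 * Q * (Q - l1)) := by positivity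
    have p3 : κ * Q ≤ 2 * (α + 2) * Q ^ 2 - 2 * ((l1 + l3) * Q - l1 * l3) - (2 * l3 + κ) * Q := by
      refine le_of_mul_le_mul_left ?_ h1
      linarith
    have p4 : κ * l1 ≤ κ * Q := by gcongr
    linarith
  have := mul_le_mul_of_nonneg_left hS (sq_nonneg s)
  linarith

lemma exists_scaledForm_lower_bound {A0 : Fin 3 → Fin 3 → ℝ} (hA : ∀ j k, A0 j k = A0 k j)
    {α l1 l3 : ℝ} (hα : 0 < α) (h1 : 0 < l1) (h3 : 0 < l3) (hgap : l3 < (1 + α) * l1)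
    (hspec : ∀ ξ : Fin 3 → ℝ,
      l1 * (∑ i, ξ i ^ 2) ≤ ∑ j, ∑ k, A0 j k * ξ j * ξ k ∧
      ∑ j, (∑ k, A0 j k * ξ k) ^ 2 ≤ l3 * ∑ j, ∑ k, A0 j k * ξ j * ξ k ∧
      ∑ j, (∑ k, A0 j k * ξ k) ^ 2 ≤
        (l1 + l3) * (∑ j, ∑ k, A0 j k * ξ j * ξ k) - l1 * l3 * ∑ i, ξ i ^ 2) :
    ∃ g c ε : ℝ, 0 < c ∧ 0 < ε ∧ ∀ (A : Fin 3 → Fin 3 → ℝ) (B : Fin 3 → Fin 3 → Fin 3 → ℝ)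
      (h δ : ℝ), (∀ j k, |A j k - A0 j k| < ε) → (∀ i j k, |B i j k| < ε) → |h - (α + 2)| < ε →
      |δ| < ε → ∀ ω : Fin 3 → ℝ, ∑ i, ω i ^ 2 = 1 → ∀ (s : ℝ) (ξ : Fin 3 → ℝ),
      c * (s ^ 2 + ∑ i, ξ i ^ 2) ≤ scaledForm A0 α g A B h δ ω s ξ := by
  obtain ⟨κ, hκ, hκe⟩ : ∃ κ, 0 < κ ∧ (1 + α) * l1 = l3 + κ :=
    ⟨(1 + α) * l1 - l3, by linarith, by ring⟩
  set g := 2 * l3 + κ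
  have hc : 0 < κ * l1 := by positivity
  set K : Set ((Fin 3 → ℝ) × ℝ × (Fin 3 → ℝ)) :=
    {z | ∑ i, z.1 i ^ 2 = 1 ∧ z.2.1 ^ 2 + ∑ i, z.2.2 i ^ 2 = 1} with hK
  have hKc : IsCompact K := by
    refine (isCompact_closedBall (0 : (Fin 3 → ℝ) × ℝ × (Fin 3 → ℝ)) 1).of_isClosed_subset ?_ ?_
    · refine IsClosed.inter ?_ ?_
      · exact isClosed_eq (by fun_prop) continuous_const
      · exact isClosed_eq (by fun_prop) continuous_const
    · rintro ⟨ω, s, ξ⟩ ⟨hω, hz⟩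
      simp only at hω hz
      have hle : ∀ (v : Fin 3 → ℝ), ∑ i, v i ^ 2 ≤ 1 → ∀ i, |v i| ≤ 1 := by
        intro v hv i
        rw [← sq_le_one_iff_abs_le_one]
        exact (single_le_sum (f := fun i => v i ^ 2) (fun _ _ => sq_nonneg _) (mem_univ i)).trans hv
      have hξ : 0 ≤ ∑ i, ξ i ^ 2 := by positivity
      rw [mem_closedBall_zero_iff, Prod.norm_def, Prod.norm_def, sup_le_iff, sup_le_iff]
      refine ⟨?_, ?_, ?_⟩
      · rw [pi_norm_le_iff_of_nonneg zero_le_one]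
        exact hle ω hω.le
      · change |s| ≤ 1
        rw [← sq_le_one_iff_abs_le_one]
        linarith
      · rw [pi_norm_le_iff_of_nonneg zero_le_one]
        exact hle ξ (by nlinarith [sq_nonneg s])
  have hev := hKc.eventually_forall_of_forall_eventually
    (x₀ := (A0, (0 : Fin 3 → Fin 3 → Fin 3 → ℝ), α + 2, (0 : ℝ)))
    (P := fun p z => κ * l1 / 2 <
      scaledForm A0 α g p.1 p.2.1 p.2.2.1 p.2.2.2 z.1 z.2.1 z.2.2) (by
    rintro ⟨ω, s, ξ⟩ ⟨hω, hz⟩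
    refine (continuous_scaledForm A0 α g).continuousAt.eventually (lt_mem_nhds ?_)
    have := le_scaledForm_limit hA hα h1 h3 hκ hκe hspec hω s ξ
    rw [show s ^ 2 + ∑ i, ξ i ^ 2 = 1 from hz, mul_one] at this
    exact lt_of_lt_of_le (half_lt_self hc) this)
  obtain ⟨ε, hε, hball⟩ := Metric.eventually_nhds_iff.1 hev
  refine ⟨g, κ * l1 / 2, ε, by positivity, hε, ?_⟩
  intro A B h δ h_A h_B hh hδ ω hω s ξ
  have hd : dist (A, B, h, δ) (A0, (0 : Fin 3 → Fin 3 → Fin 3 → ℝ), α + 2, (0 : ℝ)) < ε := by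
    simp only [Prod.dist_eq, sup_lt_iff, dist_pi_lt_iff hε, Real.dist_eq]
    exact ⟨h_A, by simpa using h_B, hh, by simpa using hδ⟩
  have hpos := hball hd
  set n := s ^ 2 + ∑ i, ξ i ^ 2 with hn
  have hn0 : 0 ≤ n := by positivity
  rcases hn0.eq_or_lt with h0 | h0
  · have hs : s = 0 := by
      have : 0 ≤ ∑ i, ξ i ^ 2 := by positivity
      nlinarith [sq_nonneg s]
    have hξ : ξ = fun _ => 0 := by
      ext i
      have := single_le_sum (f := fun i => ξ i ^ 2) (fun _ _ => sq_nonneg _) (mem_univ i)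
      nlinarith [sq_nonneg s, sq_nonneg (ξ i)]
    have := scaledForm_smul A0 α g A B h δ ω 0 s ξ
    simp only [zero_mul] at this
    rw [← h0, hs, hξ, this]
    simp
  · have hsq : Real.sqrt n ^ 2 = n := Real.sq_sqrt hn0
    have hsn : 0 < Real.sqrt n := Real.sqrt_pos.2 h0
    have h2 := hpos (ω, (Real.sqrt n)⁻¹ * s, fun i => (Real.sqrt n)⁻¹ * ξ i) ⟨hω, by
      simp only [mul_pow, ← mul_sum, ← mul_add]
      rw [← hn, inv_pow, hsq]
      field_simp⟩
    simp only [scaledForm_smul, inv_pow, hsq] at h2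
    rw [inv_mul_eq_div, lt_div_iff₀ h0] at h2
    exact h2.le

end Positivity

/-- A test function with vanishing integral. -/
def IsNullTest (U : Set E3) (f : E3 → ℝ) : Prop := IsTest U f ∧ ∫ x, f x = 0

namespace IsNullTest

variable {U : Set E3} {f g : E3 → ℝ}

lemma sub (hU : IsOpen U) (hf : IsNullTest U f) (hg : IsNullTest U g) :
    IsNullTest U (fun x => f x - g x) :=
  ⟨hf.1.sub hU hg.1, by rw [integral_sub hf.1.integrable hg.1.integrable, hf.2, hg.2, sub_zero]⟩

lemma const_mul (hU : IsOpen U) (a : ℝ) (hf : IsNullTest U f) : IsNullTest U (fun x => a * f x) :=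
  ⟨hf.1.const_mul hU a, by rw [integral_const_mul, hf.2, mul_zero]⟩

lemma sum {ι : Type*} (s : Finset ι) {F : ι → E3 → ℝ} (hF : ∀ i ∈ s, IsNullTest U (F i)) :
    IsNullTest U (fun x => ∑ i ∈ s, F i x) :=
  ⟨IsTest.sum s fun i hi => (hF i hi).1, by
    rw [integral_finsetSum s fun i hi => (hF i hi).1.integrable]
    exact sum_eq_zero fun i hi => (hF i hi).2⟩

end IsNullTest

lemma isNullTest_pdMul3 {U : Set E3} {f g c : E3 → ℝ} (hU : IsOpen U) (i : Fin 3)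
    (hc : ContDiffOn ℝ (⊤ : ℕ∞) c U) (hf : IsTest U f) (hg : IsTest U g) :
    IsNullTest U (pdMul3 i c f g) :=
  ⟨isTest_pdMul3 hU i hc hf hg, integral_pdMul3 hU i hc hf hg⟩

/-- Integration by parts identity behind the Carleman estimate: pairing `-op2 a u - q u` with
`2 β · ∇u + e u` gives the quadratic form `carlemanForm` up to a divergence. -/
lemma exists_carlemanForm_eq {U : Set E3} (hU : IsOpen U) {a : Fin 3 → Fin 3 → E3 → ℝ}
    (ha : ∀ j k, ContDiffOn ℝ (⊤ : ℕ∞) (a j k) U) (hsym : ∀ j k x, a j k x = a k j x)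
    {β : Fin 3 → E3 → ℝ} (hβ : ∀ l, ContDiffOn ℝ (⊤ : ℕ∞) (β l) U) {q e : E3 → ℝ}
    (hq : ContDiffOn ℝ (⊤ : ℕ∞) q U) (he : ContDiffOn ℝ (⊤ : ℕ∞) e U) {u : E3 → ℝ}
    (hu : IsTest U u) :
    ∃ D : E3 → ℝ, IsNullTest U D ∧ ∀ x ∈ U,
      (-op2 a u x - q x * u x) * (2 * (∑ l, β l x * pd l u x) + e x * u x) =
      carlemanForm (fun j k => a j k x) (fun i j k => pd i (a j k) x) (fun l => β l x)
        (fun j l => pd j (β l) x) (q x) (fun j => pd j q x) (e x)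
        (fun k => ∑ j, pd j (fun y => e y * a j k y) x) (u x) (fun l => pd l u x) + D x := by
  refine ⟨fun x => ((∑ j, ∑ k, ∑ l, (pdMul3 j (fun y => β j y * a k l y) (pd k u) (pd l u) x -
      2 * pdMul3 j (fun y => a j k y * β l y) (pd k u) (pd l u) x)) -
      ∑ j, pdMul3 j (fun y => q y * β j y) u u x) -
      ∑ j, ∑ k, pdMul3 j (fun y => e y * a j k y) u (pd k u) x, ?_, ?_⟩
  · refine IsNullTest.sub hU (IsNullTest.sub hU ?_ ?_) ?_
    · exact IsNullTest.sum _ fun j _ => IsNullTest.sum _ fun k _ => IsNullTest.sum _ fun l _ =>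
        IsNullTest.sub hU (isNullTest_pdMul3 hU j ((hβ j).mul (ha k l)) (hu.pd k) (hu.pd l))
          ((isNullTest_pdMul3 hU j ((ha j k).mul (hβ l)) (hu.pd k) (hu.pd l)).const_mul hU 2)
    · exact IsNullTest.sum _ fun j _ => isNullTest_pdMul3 hU j (hq.mul (hβ j)) hu hu
    · exact IsNullTest.sum _ fun j _ => IsNullTest.sum _ fun k _ =>
        isNullTest_pdMul3 hU j (he.mul (ha j k)) hu (hu.pd k)
  · intro x hx
    have da : ∀ j k, DifferentiableAt ℝ (a j k) x :=
      fun j k => (ha j k).differentiableAt_of_isOpen hU hx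
    have dβ : ∀ l, DifferentiableAt ℝ (β l) x := fun l => (hβ l).differentiableAt_of_isOpen hU hx
    have dq := hq.differentiableAt_of_isOpen hU hx
    have e1 : ∀ j k l, pd j (fun y => β j y * a k l y) x =
        pd j (β j) x * a k l x + β j x * pd j (a k l) x := fun j k l => pd_mul j (dβ j) (da k l)
    have e2 : ∀ j k l, pd j (fun y => a j k y * β l y) x =
        pd j (a j k) x * β l x + a j k x * pd j (β l) x := fun j k l => pd_mul j (da j k) (dβ l)
    have e3 : ∀ j, pd j (fun y => q y * β j y) x = pd j q x * β j x + q x * pd j (β j) x :=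
      fun j => pd_mul j dq (dβ j)
    have c10 : pd 1 (pd 0 u) x = pd 0 (pd 1 u) x := hu.pd_comm 1 0
    have c20 : pd 2 (pd 0 u) x = pd 0 (pd 2 u) x := hu.pd_comm 2 0
    have c21 : pd 2 (pd 1 u) x = pd 1 (pd 2 u) x := hu.pd_comm 2 1
    simp only [carlemanForm, pdMul3, op2, e1, e2, e3, Fin.sum_univ_three, c10, c20, c21,
      hsym 1 0 x, hsym 2 0 x, hsym 2 1 x]
    ring

section Radial

lemma pd_norm_rpow (p : ℝ) (i : Fin 3) {x : E3} (hx : x ≠ 0) :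
    pd i (fun y => ‖y‖ ^ p) x = p * ‖x‖ ^ (p - 2) * x i := by
  have hn : 0 < ‖x‖ := norm_pos_iff.2 hx
  have h1 : HasFDerivAt (fun y : E3 => ‖y‖ ^ 2) (2 • innerSL ℝ x) x := by
    simpa using (hasFDerivAt_id x).norm_sq
  have h2 := h1.rpow_const (p := p / 2) (Or.inl (by positivity))
  have h3 : (fun y : E3 => ‖y‖ ^ p) = fun y => (‖y‖ ^ 2) ^ (p / 2) := by
    ext y
    rw [← Real.rpow_natCast, ← Real.rpow_mul (norm_nonneg y)]
    congr 1
    push_cast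
    ring
  rw [pd, h3, h2.fderiv]
  have h4 : (‖x‖ ^ 2) ^ (p / 2 - 1) = ‖x‖ ^ (p - 2) := by
    rw [← Real.rpow_natCast, ← Real.rpow_mul hn.le]
    congr 1
    push_cast
    ring
  simp [h4, EuclideanSpace.inner_single_right]
  ring

lemma contDiffOn_norm_rpow {U : Set E3} (hU : (0 : E3) ∉ U) (p : ℝ) :
    ContDiffOn ℝ (⊤ : ℕ∞) (fun y : E3 => ‖y‖ ^ p) U := by
  intro x hx
  have h0 : x ≠ 0 := fun h => hU (h ▸ hx)
  exact (((contDiffAt_norm ℝ h0).rpow_const_of_ne (norm_ne_zero_iff.2 h0))).contDiffWithinAt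

/-- A radial weight `Θ` with logarithmic gradient `-k x`, where `k` has gradient
`-(k h / ‖x‖²) x`. -/
structure RadialWeight (U : Set E3) (Θ k h : E3 → ℝ) : Prop where
  smooth : ContDiffOn ℝ (⊤ : ℕ∞) Θ U
  smooth_k : ContDiffOn ℝ (⊤ : ℕ∞) k U
  pos_k : ∀ x ∈ U, 0 < k x
  pd_eq : ∀ j, ∀ x ∈ U, pd j Θ x = -(k x * x j * Θ x)
  pd_k_eq : ∀ j, ∀ x ∈ U, pd j k x = -(k x * h x / ‖x‖ ^ 2 * x j)

variable {U : Set E3} {Θ k h : E3 → ℝ}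

lemma RadialWeight.pd_mul_test (hΘ : RadialWeight U Θ k h) (hU : IsOpen U) {v : E3 → ℝ}
    (hv : IsTest U v) (j : Fin 3) {x : E3} (hx : x ∈ U) :
    pd j (fun y => Θ y * v y) x = Θ x * (pd j v x - k x * x j * v x) := by
  rw [pd_mul j (hΘ.smooth.differentiableAt_of_isOpen hU hx) hv.differentiableAt, hΘ.pd_eq j x hx]
  ring

lemma RadialWeight.pd_pd_mul_test (hΘ : RadialWeight U Θ k h) (hU : IsOpen U) {v : E3 → ℝ}
    (hv : IsTest U v) (i j : Fin 3) {x : E3} (hx : x ∈ U) :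
    pd i (pd j (fun y => Θ y * v y)) x = Θ x * (pd i (pd j v) x - k x * x i * pd j v x -
      k x * x j * pd i v x + (k x ^ 2 * x i * x j + k x * h x / ‖x‖ ^ 2 * x i * x j -
      k x * if i = j then 1 else 0) * v x) := by
  have hev : pd j (fun y => Θ y * v y) =ᶠ[nhds x]
      fun y => Θ y * (pd j v y - k y * y j * v y) := by
    filter_upwards [hU.mem_nhds hx] with y hy using hΘ.pd_mul_test hU hv j hy
  have dΘ := hΘ.smooth.differentiableAt_of_isOpen hU hx
  have dk := hΘ.smooth_k.differentiableAt_of_isOpen hU hx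
  have dx : DifferentiableAt ℝ (fun y : E3 => y j) x :=
    (contDiffOn_coord (U := U) j).differentiableAt_of_isOpen hU hx
  have dv : DifferentiableAt ℝ v x := hv.differentiableAt
  have dvj : DifferentiableAt ℝ (pd j v) x := (hv.pd j).differentiableAt
  rw [hev.pd_eq i, pd_mul i (g := fun y => pd j v y - k y * y j * v y) dΘ
      (dvj.sub ((dk.mul dx).mul dv)),
    pd_sub i (g := fun y => k y * y j * v y) dvj ((dk.mul dx).mul dv),
    pd_mul i (f := fun y => k y * y j) (dk.mul dx) dv, pd_mul i dk dx, pd_coord,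
    hΘ.pd_eq i x hx, hΘ.pd_k_eq i x hx]
  ring

/-- Conjugation of a second-order operator by a radial weight. -/
lemma RadialWeight.mul_op2 (hΘ : RadialWeight U Θ k h) (hU : IsOpen U)
    {a : Fin 3 → Fin 3 → E3 → ℝ} (hsym : ∀ j k x, a j k x = a k j x) {v : E3 → ℝ}
    (hv : IsTest U v) {x : E3} (hx : x ∈ U) :
    Θ x * op2 a v x = op2 a (fun y => Θ y * v y) x
      + k x ^ 2 * (∑ l, ∑ m, a l m x * x l * x m) * (Θ x * v x)
      + 2 * (∑ l, k x * (∑ m, a l m x * x m) * pd l (fun y => Θ y * v y) x)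
      - k x * (h x / ‖x‖ ^ 2 * (∑ l, ∑ m, a l m x * x l * x m) - ∑ l, a l l x) *
        (Θ x * v x) := by
  simp only [op2, hΘ.pd_pd_mul_test hU hv _ _ hx, hΘ.pd_mul_test hU hv _ hx, Fin.sum_univ_three,
    hsym 1 0 x, hsym 2 0 x, hsym 2 1 x, Fin.isValue, Fin.reduceEq, if_true, if_false]
  ring

end Radial

section Core

variable {U : Set E3} {Θ k h : E3 → ℝ} {a : Fin 3 → Fin 3 → E3 → ℝ} {A0 : Fin 3 → Fin 3 → ℝ}
  {α g : ℝ}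

/-- The zeroth order multiplier `angular`, as a function on `ℝ³`. -/
def angularFun (A0 : Fin 3 → Fin 3 → ℝ) (α g : ℝ) (y : E3) : ℝ :=
  (α + 2) * ((∑ j, ∑ k, A0 j k * y j * y k) * ‖y‖ ^ (-2 : ℝ)) - (∑ j, A0 j j) + g

lemma rpow_neg_two_eq {r : ℝ} (hr : 0 < r) : r ^ (-2 : ℝ) = (r ^ 2)⁻¹ := by
  rw [Real.rpow_neg hr.le, ← Real.rpow_natCast]
  norm_num

lemma angularFun_eq {x : E3} (hx : x ≠ 0) :
    angularFun A0 α g x = angular A0 α g (fun i => x i / ‖x‖) := by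
  have hn : 0 < ‖x‖ := norm_pos_iff.2 hx
  rw [angularFun, angular, rpow_neg_two_eq hn, sum_mul]
  congr 4
  ext j
  rw [sum_mul]
  refine sum_congr rfl fun k _ => ?_
  field_simp

lemma contDiffOn_angularFun (h0 : (0 : E3) ∉ U) :
    ContDiffOn ℝ (⊤ : ℕ∞) (angularFun A0 α g) U := by
  refine ContDiffOn.add (ContDiffOn.sub (contDiffOn_const.mul (ContDiffOn.mul ?_
    (contDiffOn_norm_rpow h0 _))) contDiffOn_const) contDiffOn_const
  exact ContDiffOn.sum fun j _ => ContDiffOn.sum fun k _ =>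
    (contDiffOn_const.mul (contDiffOn_coord j)).mul (contDiffOn_coord k)

lemma differentiableAt_coord (j : Fin 3) {x : E3} : DifferentiableAt ℝ (fun y : E3 => y j) x :=
  (contDiffOn_coord (U := Set.univ) j).differentiableAt_of_isOpen isOpen_univ (Set.mem_univ x)

lemma pd_quadratic {F : Fin 3 → Fin 3 → E3 → ℝ} {x : E3} (hF : ∀ l m, DifferentiableAt ℝ (F l m) x)
    (hsym : ∀ l m, F l m x = F m l x) (j : Fin 3) :
    pd j (fun y => ∑ l, ∑ m, F l m y * y l * y m) x =
      (∑ l, ∑ m, pd j (F l m) x * x l * x m) + 2 * ∑ m, F j m x * x m := by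
  have dx : ∀ l, DifferentiableAt ℝ (fun y : E3 => y l) x := fun l => differentiableAt_coord l
  rw [pd_sum _ (fun l y => ∑ m, F l m y * y l * y m) j fun l _ => DifferentiableAt.fun_sum
    fun m _ => ((hF l m).mul (dx l)).mul (dx m)]
  have e1 : ∀ l, pd j (fun y => ∑ m, F l m y * y l * y m) x = ∑ m,
      ((pd j (F l m) x * x l + F l m x * if j = l then 1 else 0) * x m +
        F l m x * x l * if j = m then 1 else 0) := by
    intro l
    rw [pd_sum _ (fun m y => F l m y * y l * y m) j fun m _ => ((hF l m).mul (dx l)).mul (dx m)]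
    refine sum_congr rfl fun m _ => ?_
    rw [pd_mul j (f := fun y => F l m y * y l) ((hF l m).mul (dx l)) (dx m),
      pd_mul j (hF l m) (dx l), pd_coord, pd_coord]
  simp only [e1]
  fin_cases j <;>
  simp [Fin.sum_univ_three, hsym 1 0, hsym 2 0, hsym 2 1] <;> ring

lemma pd_angularFun {x : E3} (hx : x ≠ 0) (hA : ∀ j k, A0 j k = A0 k j) (j : Fin 3) :
    pd j (angularFun A0 α g) x = (α + 2) / ‖x‖ * (2 * (∑ k, A0 j k * (x k / ‖x‖)) -
      2 * (x j / ‖x‖) * ∑ l, ∑ m, A0 l m * (x l / ‖x‖) * (x m / ‖x‖)) := by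
  have hn : 0 < ‖x‖ := norm_pos_iff.2 hx
  have hU : (0 : E3) ∉ ({0}ᶜ : Set E3) := by simp
  have hxU : x ∈ ({0}ᶜ : Set E3) := hx
  have dq : DifferentiableAt ℝ (fun y : E3 => ∑ j, ∑ k, A0 j k * y j * y k) x :=
    DifferentiableAt.fun_sum fun j _ => DifferentiableAt.fun_sum fun k _ =>
      ((differentiableAt_coord j).const_mul _).mul (differentiableAt_coord k)
  have dn : DifferentiableAt ℝ (fun y : E3 => ‖y‖ ^ (-2 : ℝ)) x :=
    (contDiffOn_norm_rpow hU _).differentiableAt_of_isOpen isOpen_compl_singleton hxU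
  have e0 : angularFun A0 α g = fun y => (α + 2) * ((∑ j, ∑ k, A0 j k * y j * y k) *
      ‖y‖ ^ (-2 : ℝ)) + (g - ∑ j, A0 j j) := by
    ext y
    rw [angularFun]
    ring
  rw [e0, pd_add j (f := fun y => (α + 2) * ((∑ j, ∑ k, A0 j k * y j * y k) * ‖y‖ ^ (-2 : ℝ)))
      ((dq.mul dn).const_mul _) (differentiableAt_const _), pd_const,
    pd_const_mul j (α + 2) (f := fun y => (∑ j, ∑ k, A0 j k * y j * y k) * ‖y‖ ^ (-2 : ℝ))
      (dq.mul dn), pd_mul j dq dn, pd_norm_rpow _ _ hx,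
    pd_quadratic (F := fun l m _ => A0 l m) (fun _ _ => differentiableAt_const _) hA]
  have e4 : ‖x‖ ^ (-2 - 2 : ℝ) = (‖x‖ ^ 4)⁻¹ := by
    rw [show (-2 - 2 : ℝ) = -(4 : ℕ) by norm_num, Real.rpow_neg hn.le, Real.rpow_natCast]
  rw [e4, rpow_neg_two_eq hn]
  simp only [pd_const, Fin.sum_univ_three]
  field_simp
  ring

/-- The form `carlemanForm` of a radial weight, in terms of the normalized form. -/
lemma RadialWeight.carlemanForm_eq (hΘ : RadialWeight U Θ k h) (hU : IsOpen U)
    (ha : ∀ j k, ContDiffOn ℝ (⊤ : ℕ∞) (a j k) U) (hsym : ∀ j k x, a j k x = a k j x)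
    (hA : ∀ j k, A0 j k = A0 k j) {x : E3} (hx : x ∈ U) (hx0 : x ≠ 0) (s : ℝ) (ξ : Fin 3 → ℝ) :
    carlemanForm (fun j k => a j k x) (fun i j k => pd i (a j k) x)
      (fun l => -(k x * ∑ m, a l m x * x m))
      (fun j l => pd j (fun y => -(k y * ∑ m, a l m y * y m)) x)
      (k x ^ 2 * ∑ l, ∑ m, a l m x * x l * x m)
      (fun j => pd j (fun y => k y ^ 2 * ∑ l, ∑ m, a l m y * y l * y m) x)
      (k x * angularFun A0 α g x)
      (fun i => ∑ j, pd j (fun y => k y * angularFun A0 α g y * a j i y) x) s ξ =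
    k x * scaledForm A0 α g (fun j k => a j k x) (fun i j k => ‖x‖ * pd i (a j k) x) (h x)
      (1 / (k x * ‖x‖ ^ 2)) (fun i => x i / ‖x‖) (k x * ‖x‖ * s) ξ +
    1 / 2 * (k x * angularFun A0 α g x - k x * (h x / ‖x‖ ^ 2 *
      (∑ l, ∑ m, a l m x * x l * x m) - ∑ l, a l l x)) ^ 2 * s ^ 2 := by
  have hn : 0 < ‖x‖ := norm_pos_iff.2 hx0
  have hk := hΘ.pos_k x hx
  have da : ∀ j k, DifferentiableAt ℝ (a j k) x :=
    fun j k => (ha j k).differentiableAt_of_isOpen hU hx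
  have dk := hΘ.smooth_k.differentiableAt_of_isOpen hU hx
  have dx : ∀ l, DifferentiableAt ℝ (fun y : E3 => y l) x := fun l => differentiableAt_coord l
  have dE : DifferentiableAt ℝ (angularFun A0 α g) x :=
    (contDiffOn_angularFun (U := {0}ᶜ) (by simp)).differentiableAt_of_isOpen
      isOpen_compl_singleton hx0
  set r := ‖x‖ with hr
  set ω : Fin 3 → ℝ := fun i => x i / r with hω
  have hxω : ∀ i, x i = r * ω i := fun i => by simp only [hω]; field_simp
  have hE : angularFun A0 α g x = angular A0 α g ω := angularFun_eq hx0
  have e1 : (fun i j k => pd i (a j k) x) = fun i j k => r * pd i (a j k) x / r := by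
    ext i j k
    field_simp
  have e2 : (fun l => -(k x * ∑ m, a l m x * x m)) = fun l => k x * r * -∑ m, a l m x * ω m := by
    ext l
    simp only [hxω, Fin.sum_univ_three]
    ring
  have e3 : (fun j l => pd j (fun y => -(k y * ∑ m, a l m y * y m)) x) = fun j l => k x *
      (h x * ω j * (∑ m, a l m x * ω m) - a l j x - ∑ m, r * pd j (a l m) x * ω m) := by
    ext j l
    have ds : ∀ m ∈ (univ : Finset (Fin 3)), DifferentiableAt ℝ (fun y => a l m y * y m) x :=
      fun m _ => (da l m).mul (dx m)
    rw [pd_neg, pd_mul j (g := fun y => ∑ m, a l m y * y m) dk (DifferentiableAt.fun_sum ds),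
      pd_sum _ (fun m y => a l m y * y m) j ds, hΘ.pd_k_eq j x hx]
    have : ∀ m, pd j (fun y => a l m y * y m) x = pd j (a l m) x * x m +
        a l m x * if j = m then 1 else 0 := fun m => by rw [pd_mul j (da l m) (dx m), pd_coord]
    simp only [this, sum_add_distrib, mul_ite, mul_one, mul_zero, sum_ite_eq, mem_univ, if_true]
    rw [← hr]
    simp only [hxω, Fin.sum_univ_three]
    field_simp
    ring
  have e4 : k x ^ 2 * (∑ l, ∑ m, a l m x * x l * x m) =
      k x ^ 2 * r ^ 2 * ∑ l, ∑ m, a l m x * ω l * ω m := by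
    simp only [hxω, Fin.sum_univ_three]
    ring
  have e5 : (fun j => pd j (fun y => k y ^ 2 * ∑ l, ∑ m, a l m y * y l * y m) x) = fun j =>
      k x ^ 2 * r * (-(2 * h x * ω j * (∑ l, ∑ m, a l m x * ω l * ω m)) +
        2 * (∑ m, a j m x * ω m) + ∑ l, ∑ m, r * pd j (a l m) x * ω l * ω m) := by
    ext j
    have ds : DifferentiableAt ℝ (fun y => ∑ l, ∑ m, a l m y * y l * y m) x :=
      DifferentiableAt.fun_sum fun l _ => DifferentiableAt.fun_sum fun m _ =>
        ((da l m).mul (dx l)).mul (dx m)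
    have hk2 : pd j (fun y => k y ^ 2) x = 2 * k x * pd j k x := by
      simp only [pow_two]
      rw [pd_mul j dk dk]
      ring
    rw [pd_mul j (f := fun y => k y ^ 2) (dk.pow 2) ds, hk2, hΘ.pd_k_eq j x hx,
      pd_quadratic da (fun l m => hsym l m x), ← hr]
    simp only [hxω, Fin.sum_univ_three]
    field_simp
    ring
  have e6 : (fun i => ∑ j, pd j (fun y => k y * angularFun A0 α g y * a j i y) x) = fun i =>
      k x ^ 2 * r * (1 / (k x * r ^ 2) * ∑ j, (angularGrad A0 α g (h x) ω j * a j i x +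
        angular A0 α g ω * (r * pd j (a j i) x))) := by
    ext i
    rw [mul_sum, mul_sum]
    refine sum_congr rfl fun j _ => ?_
    rw [pd_mul j (f := fun y => k y * angularFun A0 α g y) (dk.mul dE) (da j i), pd_mul j dk dE,
      hΘ.pd_k_eq j x hx, pd_angularFun hx0 hA, hE, ← hr, hxω j, angularGrad]
    simp only [hω]
    field_simp
  have e7 : h x / r ^ 2 * (∑ l, ∑ m, a l m x * x l * x m) =
      h x * ∑ l, ∑ m, a l m x * ω l * ω m := by
    simp only [hxω, Fin.sum_univ_three]
    field_simp
  rw [e1, e2, e3, e4, e5, e6, e7, hE, carlemanForm_scale hk.ne' hn.ne', scaledForm]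
  have key : ∀ X E P : ℝ, k x * X = k x * (X - 1 / 2 * (1 / (k x * r ^ 2)) * (E - P) ^ 2 *
      (k x * r * s) ^ 2) + 1 / 2 * (k x * E - k x * P) ^ 2 * s ^ 2 := by
    intro X E P
    field_simp
    ring
  exact key _ _ _

end Core

section CoreEstimate

lemma sqJet_one_eq (f : E3 → ℝ) (x : E3) : sqJet 1 f x = ∑ i, pd i f x ^ 2 := rfl

/-- Carleman estimate for a second-order operator with a radial weight, under the positivity of
the normalized form. -/
lemma RadialWeight.integral_le {U : Set E3} {Θ k h : E3 → ℝ} {a : Fin 3 → Fin 3 → E3 → ℝ}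
    {A0 : Fin 3 → Fin 3 → ℝ} {α g c ε : ℝ} (hΘ : RadialWeight U Θ k h) (hU : IsOpen U)
    (h0 : (0 : E3) ∉ U)
    (ha : ∀ j k, ContDiffOn ℝ (⊤ : ℕ∞) (a j k) U) (hsym : ∀ j k x, a j k x = a k j x)
    (hA : ∀ j k, A0 j k = A0 k j) (hc : 0 < c)
    (hlow : ∀ (A : Fin 3 → Fin 3 → ℝ) (B : Fin 3 → Fin 3 → Fin 3 → ℝ)
      (h δ : ℝ), (∀ j k, |A j k - A0 j k| < ε) → (∀ i j k, |B i j k| < ε) → |h - (α + 2)| < ε →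
      |δ| < ε → ∀ ω : Fin 3 → ℝ, ∑ i, ω i ^ 2 = 1 → ∀ (s : ℝ) (ξ : Fin 3 → ℝ),
      c * (s ^ 2 + ∑ i, ξ i ^ 2) ≤ scaledForm A0 α g A B h δ ω s ξ)
    (h_a : ∀ j k, ∀ x ∈ U, |a j k x - A0 j k| < ε)
    (h_da : ∀ i j k, ∀ x ∈ U, |‖x‖ * pd i (a j k) x| < ε)
    (hh : ∀ x ∈ U, |h x - (α + 2)| < ε) (hk : ∀ x ∈ U, |1 / (k x * ‖x‖ ^ 2)| < ε)
    {v : E3 → ℝ} (hv : IsTest U v) :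
    (∫ x, k x ^ 3 * ‖x‖ ^ (2 : ℝ) * Θ x ^ 2 * v x ^ 2) + (∫ x, k x * Θ x ^ 2 * sqJet 1 v x) ≤
      3 / (2 * c) * ∫ x, Θ x ^ 2 * op2 a v x ^ 2 := by
  set u : E3 → ℝ := fun y => Θ y * v y with hu_def
  have hu : IsTest U u := hv.coef_mul hU hΘ.smooth
  have sβ : ∀ l, ContDiffOn ℝ (⊤ : ℕ∞) (fun y => -(k y * ∑ m, a l m y * y m)) U := fun l =>
    (hΘ.smooth_k.mul (ContDiffOn.sum fun m _ => (ha l m).mul (contDiffOn_coord m))).neg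
  have sq : ContDiffOn ℝ (⊤ : ℕ∞) (fun y => k y ^ 2 * ∑ l, ∑ m, a l m y * y l * y m) U :=
    (hΘ.smooth_k.pow 2).mul (ContDiffOn.sum fun l _ => ContDiffOn.sum fun m _ =>
      ((ha l m).mul (contDiffOn_coord l)).mul (contDiffOn_coord m))
  have se : ContDiffOn ℝ (⊤ : ℕ∞) (fun y => k y * angularFun A0 α g y) U :=
    hΘ.smooth_k.mul (contDiffOn_angularFun h0)
  obtain ⟨D, hD, hform⟩ := exists_carlemanForm_eq hU ha hsym sβ sq se hu
  have t1 : IsTest U fun x => k x ^ 3 * ‖x‖ ^ (2 : ℝ) * Θ x ^ 2 * v x ^ 2 := (hv.sq hU).coef_mul hU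
    (((hΘ.smooth_k.pow 3).mul (contDiffOn_norm_rpow h0 2)).mul (hΘ.smooth.pow 2))
  have t2 : IsTest U fun x => k x * Θ x ^ 2 * sqJet 1 v x := (hv.sqJet hU 1).coef_mul hU
    (hΘ.smooth_k.mul (hΘ.smooth.pow 2))
  have t3 : IsTest U fun x => Θ x ^ 2 * op2 a v x ^ 2 :=
    ((hv.op2 hU ha).sq hU).coef_mul hU (hΘ.smooth.pow 2)
  rw [← integral_add t1.integrable t2.integrable, ← integral_const_mul]
  refine integral_le_of_le_add (t1.add t2) (t3.const_mul hU _) (hD.const_mul hU (-(3 / c))).1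
    (hD.const_mul hU _).2 fun x hx => ?_
  have hx0 : x ≠ 0 := fun h => h0 (h ▸ hx)
  have hn : 0 < ‖x‖ := norm_pos_iff.2 hx0
  have hkx := hΘ.pos_k x hx
  have hnorm : ∑ i, x i ^ 2 = ‖x‖ ^ 2 := (EuclideanSpace.real_norm_sq_eq x).symm
  have hf := hform x hx
  rw [hΘ.carlemanForm_eq hU ha hsym hA hx hx0] at hf
  have hop := hΘ.mul_op2 hU hsym hv hx
  simp only [← hu_def] at hop
  have hω : ∑ i, (x i / ‖x‖) ^ 2 = 1 := by
    simp only [div_pow, ← sum_div, hnorm]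
    field_simp
  have hl := hlow (fun j k => a j k x) (fun i j k => ‖x‖ * pd i (a j k) x) (h x)
    (1 / (k x * ‖x‖ ^ 2)) (fun j k => h_a j k x hx) (fun i j k => h_da i j k x hx) (hh x hx)
    (hk x hx) _ hω (k x * ‖x‖ * u x) (fun l => pd l u x)
  have hl2 := mul_le_mul_of_nonneg_left hl hkx.le
  generalize scaledForm _ _ _ _ _ _ _ _ _ _ = S at hf hl2
  have e1 : (∑ l, k x * (∑ m, a l m x * x m) * pd l u x) =
      -∑ l, -(k x * ∑ m, a l m x * x m) * pd l u x := by
    rw [← sum_neg_distrib]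
    exact sum_congr rfl fun l _ => by ring
  rw [e1] at hop
  generalize (∑ l, -(k x * ∑ m, a l m x * x m) * pd l u x) = T at hf hop
  generalize k x ^ 2 * (∑ l, ∑ m, a l m x * x l * x m) = q at hf hop
  generalize k x * (h x / ‖x‖ ^ 2 * (∑ l, ∑ m, a l m x * x l * x m) - ∑ l, a l l x) = p at hf hop
  generalize k x * angularFun A0 α g x = e at hf hop
  have hux : Θ x * v x = u x := rfl
  rw [hux] at hop
  have key : k x * (c * ((k x * ‖x‖ * u x) ^ 2 + ∑ i, pd i u x ^ 2)) ≤
      1 / 2 * (Θ x * op2 a v x) ^ 2 - D x := by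
    have hQ : op2 a u x = Θ x * op2 a v x - q * u x + 2 * T + p * u x := by linarith
    rw [hQ] at hf
    nlinarith [sq_nonneg (Θ x * op2 a v x + (2 * T + e * u x)),
      sq_nonneg ((e - p) * u x - (2 * T + e * u x))]
  have hgrad : Θ x ^ 2 * sqJet 1 v x ≤ 2 * (∑ i, pd i u x ^ 2) + 2 * (k x * ‖x‖ * u x) ^ 2 := by
    have : (k x * ‖x‖ * u x) ^ 2 = ∑ i, (k x * x i * u x) ^ 2 := by
      simp only [mul_pow, ← sum_mul, ← mul_sum, hnorm]
    rw [sqJet_one_eq, this, mul_sum, mul_sum, mul_sum, ← sum_add_distrib]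
    refine sum_le_sum fun i _ => ?_
    rw [hΘ.pd_mul_test hU hv i hx, ← hux]
    nlinarith [sq_nonneg (Θ x * pd i v x - 2 * (k x * x i * (Θ x * v x)))]
  have hgrad2 := mul_le_mul_of_nonneg_left hgrad hkx.le
  have hS : 0 ≤ ∑ i, pd i u x ^ 2 := sum_nonneg fun _ _ => sq_nonneg _
  have e2 : ‖x‖ ^ (2 : ℝ) = ‖x‖ ^ 2 := Real.rpow_natCast _ 2
  calc _ = k x * (k x * ‖x‖ * u x) ^ 2 + k x * (Θ x ^ 2 * sqJet 1 v x) := by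
        rw [e2, ← hux]
        ring
    _ ≤ 3 * (k x * ((k x * ‖x‖ * u x) ^ 2 + ∑ i, pd i u x ^ 2)) := by
        nlinarith [mul_nonneg hkx.le hS]
    _ = 3 / c * (k x * (c * ((k x * ‖x‖ * u x) ^ 2 + ∑ i, pd i u x ^ 2))) := by
        field_simp
    _ ≤ 3 / c * (1 / 2 * (Θ x * op2 a v x) ^ 2 - D x) := by gcongr
    _ = _ := by
        field_simp
        ring

end CoreEstimate

section Weights

/-- The Carleman weight `‖x‖ ^ p * e ^ (2 τ ‖x‖ ^ (-α))`. -/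
def wt (α τ p : ℝ) (x : E3) : ℝ := ‖x‖ ^ p * Real.exp (2 * τ * ‖x‖ ^ (-α))

/-- The integral of `F` against `τ ^ n` times a Carleman weight. -/
def wInt (α τ p : ℝ) (n : ℤ) (F : E3 → ℝ) : ℝ := τ ^ n * ∫ x, wt α τ p x * F x

variable {U : Set E3} {α τ p : ℝ} {x : E3}

lemma wt_pos (hx : x ≠ 0) : 0 < wt α τ p x :=
  mul_pos (Real.rpow_pos_of_pos (norm_pos_iff.2 hx) _) (Real.exp_pos _)

lemma wt_nonneg : 0 ≤ wt α τ p x :=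
  mul_nonneg (Real.rpow_nonneg (norm_nonneg _) _) (Real.exp_pos _).le

lemma rpow_mul_wt (hx : x ≠ 0) (q : ℝ) : ‖x‖ ^ q * wt α τ p x = wt α τ (q + p) x := by
  rw [wt, wt, Real.rpow_add (norm_pos_iff.2 hx)]
  ring

lemma contDiffOn_wt (h0 : (0 : E3) ∉ U) : ContDiffOn ℝ (⊤ : ℕ∞) (wt α τ p) U :=
  (contDiffOn_norm_rpow h0 p).mul
    (Real.contDiff_exp.comp_contDiffOn (contDiffOn_const.mul (contDiffOn_norm_rpow h0 (-α))))

lemma pd_wt (hx : x ≠ 0) (i : Fin 3) :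
    pd i (wt α τ p) x = -((2 * τ * α * ‖x‖ ^ (-α - 2) - p * ‖x‖ ^ (-2 : ℝ)) * x i * wt α τ p x) := by
  have hn : 0 < ‖x‖ := norm_pos_iff.2 hx
  have hU : (0 : E3) ∉ ({0}ᶜ : Set E3) := by simp
  have dn : ∀ q : ℝ, DifferentiableAt ℝ (fun y : E3 => ‖y‖ ^ q) x := fun q =>
    (contDiffOn_norm_rpow hU _).differentiableAt_of_isOpen isOpen_compl_singleton hx
  have de : DifferentiableAt ℝ (fun y : E3 => 2 * τ * ‖y‖ ^ (-α)) x := (dn _).const_mul _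
  have he : pd i (fun y : E3 => Real.exp (2 * τ * ‖y‖ ^ (-α))) x =
      Real.exp (2 * τ * ‖x‖ ^ (-α)) * pd i (fun y : E3 => 2 * τ * ‖y‖ ^ (-α)) x := by
    simp only [pd]
    rw [fderiv_exp de]
    simp
  have h2 : ‖x‖ ^ (p - 2) = ‖x‖ ^ p * ‖x‖ ^ (-2 : ℝ) := by
    rw [← Real.rpow_add hn, sub_eq_add_neg]
  change pd i (fun y : E3 => ‖y‖ ^ p * Real.exp (2 * τ * ‖y‖ ^ (-α))) x = _
  rw [pd_mul i (dn p) de.exp, he, pd_const_mul i _ (dn _), pd_norm_rpow _ _ hx,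
    pd_norm_rpow _ _ hx, h2, wt]
  ring

lemma IsTest.wt_mul (hU : IsOpen U) (h0 : (0 : E3) ∉ U) {F : E3 → ℝ} (hF : IsTest U F) :
    IsTest U (fun x => wt α τ p x * F x) := hF.coef_mul hU (contDiffOn_wt h0)

lemma wInt_nonneg (hτ : 0 ≤ τ) {n : ℤ} {F : E3 → ℝ} (hF0 : ∀ x, 0 ≤ F x) :
    0 ≤ wInt α τ p n F :=
  mul_nonneg (zpow_nonneg hτ n) (integral_nonneg fun x => mul_nonneg wt_nonneg (hF0 x))

lemma wInt_mono (hU : IsOpen U) (h0 : (0 : E3) ∉ U) {n : ℤ} (hτ : 0 ≤ τ) {F G : E3 → ℝ}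
    (hF : IsTest U F) (hG : IsTest U G) (h : ∀ x ∈ U, F x ≤ G x) :
    wInt α τ p n F ≤ wInt α τ p n G :=
  mul_le_mul_of_nonneg_left (integral_le_of_le (hF.wt_mul hU h0) (hG.wt_mul hU h0)
    fun x hx => mul_le_mul_of_nonneg_left (h x hx) wt_nonneg) (zpow_nonneg hτ n)

lemma wInt_weight_mono (hU : IsOpen U) (h0 : (0 : E3) ∉ U) (hU1 : ∀ x ∈ U, ‖x‖ ≤ 1) (hτ : 1 ≤ τ)
    {q : ℝ} (hqp : q ≤ p) {n m : ℤ} (hnm : n ≤ m) {F : E3 → ℝ} (hF : IsTest U F)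
    (hF0 : ∀ x, 0 ≤ F x) : wInt α τ p n F ≤ wInt α τ q m F := by
  have h1 : ∫ x, wt α τ p x * F x ≤ ∫ x, wt α τ q x * F x := by
    refine integral_le_of_le (hF.wt_mul hU h0) (hF.wt_mul hU h0) fun x hx => ?_
    have hx0 : 0 < ‖x‖ := norm_pos_iff.2 fun h => h0 (h ▸ hx)
    refine mul_le_mul_of_nonneg_right (mul_le_mul_of_nonneg_right ?_ (Real.exp_pos _).le) (hF0 x)
    exact Real.rpow_le_rpow_of_exponent_ge hx0 (hU1 x hx) hqp
  exact mul_le_mul (zpow_le_zpow_right₀ hτ hnm) h1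
    (integral_nonneg fun x => mul_nonneg wt_nonneg (hF0 x)) (zpow_nonneg (by linarith) m)

lemma wInt_add (hU : IsOpen U) (h0 : (0 : E3) ∉ U) {n : ℤ} {F G : E3 → ℝ}
    (hF : IsTest U F) (hG : IsTest U G) :
    wInt α τ p n (fun x => F x + G x) = wInt α τ p n F + wInt α τ p n G := by
  simp only [wInt, mul_add]
  rw [integral_add (hF.wt_mul hU h0).integrable (hG.wt_mul hU h0).integrable, mul_add]

lemma wInt_const_mul {n : ℤ} (b : ℝ) (F : E3 → ℝ) :
    wInt α τ p n (fun x => b * F x) = b * wInt α τ p n F := by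
  simp only [wInt]
  have : ∀ x, wt α τ p x * (b * F x) = b * (wt α τ p x * F x) := fun x => by ring
  simp only [this]
  rw [integral_const_mul]
  ring

lemma wInt_sum (hU : IsOpen U) (h0 : (0 : E3) ∉ U) {n : ℤ} {ι : Type*} (s : Finset ι)
    {F : ι → E3 → ℝ} (hF : ∀ i ∈ s, IsTest U (F i)) :
    wInt α τ p n (fun x => ∑ i ∈ s, F i x) = ∑ i ∈ s, wInt α τ p n (F i) := by
  simp only [wInt, mul_sum]
  rw [integral_finsetSum s fun i hi => ((hF i hi).wt_mul hU h0).integrable, mul_sum]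

/-- The first-order Carleman estimate, at the weight exponent `m`. -/
def CarlemanBound (U : Set E3) (α τ : ℝ) (a : Fin 3 → Fin 3 → E3 → ℝ) (m C : ℝ) : Prop :=
  ∀ (n : ℤ) (v : E3 → ℝ), IsTest U v →
    wInt α τ (m - 4 - 3 * α) (n + 3) (fun x => v x ^ 2) + wInt α τ (m - 2 - α) (n + 1) (sqJet 1 v) ≤
      C * wInt α τ m n (fun x => op2 a v x ^ 2)

/-- The weighted second-order elliptic estimate, at the weight exponent `p`. -/
def EllipticBound (U : Set E3) (α τ : ℝ) (a : Fin 3 → Fin 3 → E3 → ℝ) (p C : ℝ) : Prop :=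
  ∀ (n : ℤ) (v : E3 → ℝ), IsTest U v →
    wInt α τ p n (sqJet 2 v) ≤
      C * (wInt α τ p n (fun x => op2 a v x ^ 2) + wInt α τ (p - 2 * α - 2) (n + 2) (sqJet 1 v))

lemma abs_coord_le (x : E3) (i : Fin 3) : |x i| ≤ ‖x‖ := by
  simpa using PiLp.norm_apply_le x i

lemma one_le_rpow_neg {r q : ℝ} (hr : 0 < r) (hr1 : r ≤ 1) (hq : q ≤ 0) : 1 ≤ r ^ q :=
  Real.one_le_rpow_of_pos_of_le_one_of_nonpos hr hr1 hq

lemma EllipticCoef.exists_ellipticBound {a : Fin 3 → Fin 3 → E3 → ℝ} {c0 M : ℝ} (hU : IsOpen U)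
    (h0 : (0 : E3) ∉ U) (hU1 : ∀ x ∈ U, ‖x‖ ≤ 1) (hc0 : 0 < c0) (ha : EllipticCoef U a c0 M)
    (hα : 0 < α) (p : ℝ) : ∃ C > 0, ∀ τ ≥ 1, EllipticBound U α τ a p C := by
  set K : ℝ := |p| + 2 * α + 1 with hK
  have hK1 : 1 ≤ K := by
    have := abs_nonneg p
    linarith
  refine ⟨ellipticConst c0 M * K ^ 2, by have := ellipticConst_pos (M := M) hc0; positivity,
    fun τ hτ n v hv => ?_⟩
  have hne : ∀ x ∈ U, x ≠ 0 := fun x hx h => h0 (h ▸ hx)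
  have hN1 : ∀ x ∈ U, 1 ≤ K * τ * ‖x‖ ^ (-α - 1) := by
    intro x hx
    have := one_le_rpow_neg (norm_pos_iff.2 (hne x hx)) (hU1 x hx) (by linarith : -α - 1 ≤ 0)
    have h2 : 1 ≤ K * τ := one_le_mul_of_one_le_of_one_le hK1 hτ
    exact one_le_mul_of_one_le_of_one_le h2 this
  have hWN : ∀ i, ∀ x ∈ U, |pd i (wt α τ p) x| ≤ K * τ * ‖x‖ ^ (-α - 1) * wt α τ p x := by
    intro i x hx
    have hn := norm_pos_iff.2 (hne x hx)
    rw [pd_wt (hne x hx), abs_neg, abs_mul, abs_mul, abs_of_pos (wt_pos (hne x hx))]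
    refine mul_le_mul_of_nonneg_right ?_ wt_nonneg
    have e1 : ‖x‖ ^ (-α - 1) = ‖x‖ ^ (-α - 2) * ‖x‖ := by
      nth_rw 3 [← Real.rpow_one ‖x‖]
      rw [← Real.rpow_add hn]
      congr 1
      ring
    rw [e1, ← mul_assoc]
    refine mul_le_mul ?_ (abs_coord_le x i) (abs_nonneg _) (by positivity)
    have h1 : ‖x‖ ^ (-2 : ℝ) ≤ ‖x‖ ^ (-α - 2) :=
      Real.rpow_le_rpow_of_exponent_ge hn (hU1 x hx) (by linarith)
    have h2 : 0 < ‖x‖ ^ (-2 : ℝ) := Real.rpow_pos_of_pos hn _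
    have h3 : 0 < ‖x‖ ^ (-α - 2) := Real.rpow_pos_of_pos hn _
    calc |2 * τ * α * ‖x‖ ^ (-α - 2) - p * ‖x‖ ^ (-2 : ℝ)|
        ≤ |2 * τ * α * ‖x‖ ^ (-α - 2)| + |p * ‖x‖ ^ (-2 : ℝ)| := abs_sub _ _
      _ = 2 * τ * α * ‖x‖ ^ (-α - 2) + |p| * ‖x‖ ^ (-2 : ℝ) := by
          rw [abs_mul p, abs_of_pos h2, abs_of_pos (by positivity)]
      _ ≤ 2 * τ * α * ‖x‖ ^ (-α - 2) + |p| * (τ * ‖x‖ ^ (-α - 2)) := by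
          gcongr
          nlinarith
      _ ≤ K * τ * ‖x‖ ^ (-α - 2) := by
          have : 0 < τ * ‖x‖ ^ (-α - 2) := by positivity
          rw [hK]
          nlinarith
  have key := ha.integral_sqJet_two_le (W := wt α τ p) (N := fun x => K * τ * ‖x‖ ^ (-α - 1)) hU hc0
    (contDiffOn_wt h0) (contDiffOn_const.mul (contDiffOn_norm_rpow h0 _))
    (fun x hx => wt_pos (hne x hx)) hN1 hWN hv
  have e2 : ∫ x, (K * τ * ‖x‖ ^ (-α - 1)) ^ 2 * wt α τ p x * sqJet 1 v x =
      K ^ 2 * τ ^ 2 * ∫ x, wt α τ (p - 2 * α - 2) x * sqJet 1 v x := by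
    rw [← integral_const_mul]
    congr 1
    ext x
    by_cases hx : x ∈ U
    · have hn := norm_pos_iff.2 (hne x hx)
      have : wt α τ (p - 2 * α - 2) x = (‖x‖ ^ (-α - 1)) ^ 2 * wt α τ p x := by
        rw [pow_two, mul_assoc, rpow_mul_wt (hne x hx), rpow_mul_wt (hne x hx)]
        congr 1
        ring
      rw [this]
      ring
    · rw [(hv.sqJet hU 1).eq_zero hx]
      simp
  rw [e2] at key
  have hE := ellipticConst_pos (M := M) hc0
  have hτn : 0 < τ ^ n := zpow_pos (by linarith) n
  have hi1 : 0 ≤ ∫ x, wt α τ p x * op2 a v x ^ 2 :=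
    integral_nonneg fun x => mul_nonneg wt_nonneg (sq_nonneg _)
  calc wInt α τ p n (sqJet 2 v) ≤ τ ^ n * _ := mul_le_mul_of_nonneg_left key hτn.le
    _ ≤ τ ^ n * (ellipticConst c0 M * (K ^ 2 * (∫ x, wt α τ p x * op2 a v x ^ 2) +
        K ^ 2 * τ ^ 2 * ∫ x, wt α τ (p - 2 * α - 2) x * sqJet 1 v x)) := by
        gcongr
        exact le_mul_of_one_le_left hi1 (one_le_pow₀ hK1)
    _ = _ := by
        rw [wInt, wInt, zpow_add₀ (by linarith : τ ≠ 0)]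
        norm_cast
        ring

end Weights

section ConcreteWeights

variable {U : Set E3} {α τ m : ℝ} {x : E3}

/-- The logarithmic gradient factor of the weight `wt α (τ / 2) (m / 2)`. -/
def wtSlope (α τ m : ℝ) (x : E3) : ℝ := τ * α * ‖x‖ ^ (-α - 2) - m / 2 * ‖x‖ ^ (-2 : ℝ)

/-- The logarithmic gradient factor of `wtSlope`. -/
def wtBend (α τ m : ℝ) (x : E3) : ℝ :=
  (τ * α * (α + 2) * ‖x‖ ^ (-α - 2) - m * ‖x‖ ^ (-2 : ℝ)) / wtSlope α τ m x

lemma le_wtSlope (hm : m ≤ 0) : τ * α * ‖x‖ ^ (-α - 2) ≤ wtSlope α τ m x := by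
  have : 0 ≤ ‖x‖ ^ (-2 : ℝ) := by positivity
  rw [wtSlope]
  nlinarith

lemma wtSlope_pos (hα : 0 < α) (hτ : 0 < τ) (hm : m ≤ 0) (hx : x ≠ 0) : 0 < wtSlope α τ m x := by
  have hn := norm_pos_iff.2 hx
  exact lt_of_lt_of_le (by positivity) (le_wtSlope hm)

lemma wt_half_sq (hx : x ≠ 0) : wt α (τ / 2) (m / 2) x ^ 2 = wt α τ m x := by
  have hn := norm_pos_iff.2 hx
  rw [wt, wt, mul_pow, ← Real.rpow_natCast (‖x‖ ^ (m / 2)), ← Real.rpow_mul hn.le, ← Real.exp_nat_mul]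
  push_cast
  congr 2 <;> ring

lemma radialWeight_wt (h0 : (0 : E3) ∉ U) (hα : 0 < α) (hτ : 0 < τ) (hm : m ≤ 0) :
    RadialWeight U (wt α (τ / 2) (m / 2)) (wtSlope α τ m) (wtBend α τ m) where
  smooth := contDiffOn_wt h0
  smooth_k := (contDiffOn_const.mul (contDiffOn_norm_rpow h0 _)).sub
    (contDiffOn_const.mul (contDiffOn_norm_rpow h0 _))
  pos_k x hx := wtSlope_pos hα hτ hm fun h => h0 (h ▸ hx)
  pd_eq j x hx := by
    rw [pd_wt (fun h => h0 (h ▸ hx)), wtSlope]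
    ring
  pd_k_eq j x hx := by
    have hx0 : x ≠ 0 := fun h => h0 (h ▸ hx)
    have hn := norm_pos_iff.2 hx0
    have hU : (0 : E3) ∉ ({0}ᶜ : Set E3) := by simp
    have dn : ∀ q : ℝ, DifferentiableAt ℝ (fun y : E3 => ‖y‖ ^ q) x := fun q =>
      (contDiffOn_norm_rpow hU _).differentiableAt_of_isOpen isOpen_compl_singleton hx0
    have e : ∀ q : ℝ, ‖x‖ ^ (q - 2) = ‖x‖ ^ q / ‖x‖ ^ 2 := fun q => by
      rw [Real.rpow_sub hn, Real.rpow_two]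
    have hk := wtSlope_pos hα hτ hm hx0
    change pd j (fun y => τ * α * ‖y‖ ^ (-α - 2) - m / 2 * ‖y‖ ^ (-2 : ℝ)) x = _
    rw [wtBend, mul_div_cancel₀ _ hk.ne', pd_sub j ((dn _).const_mul _) ((dn _).const_mul _),
      pd_const_mul j _ (dn _), pd_const_mul j _ (dn _), pd_norm_rpow _ _ hx0, pd_norm_rpow _ _ hx0,
      e (-α - 2), e (-2)]
    field_simp
    ring

lemma abs_wtBend_sub_le (hα : 0 < α) (hτ : 0 < τ) (hm : m ≤ 0) (hx : x ≠ 0) (hx1 : ‖x‖ ≤ 1) :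
    |wtBend α τ m x - (α + 2)| ≤ -m / 2 / τ := by
  have hn := norm_pos_iff.2 hx
  have hk := wtSlope_pos hα hτ hm hx
  have h1 : ‖x‖ ^ (-2 : ℝ) ≤ ‖x‖ ^ (-α - 2) :=
    Real.rpow_le_rpow_of_exponent_ge hn hx1 (by linarith)
  have h2 : 0 < ‖x‖ ^ (-2 : ℝ) := Real.rpow_pos_of_pos hn _
  have e : wtBend α τ m x - (α + 2) = -((α * (-m / 2) * ‖x‖ ^ (-2 : ℝ)) / wtSlope α τ m x) := by
    rw [wtBend, div_sub' hk.ne', ← neg_div]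
    congr 1
    rw [wtSlope]
    ring
  have hm' : 0 ≤ -m / 2 := by linarith
  rw [e, abs_neg, abs_of_nonneg (by positivity), div_le_div_iff₀ hk hτ]
  calc α * (-m / 2) * ‖x‖ ^ (-2 : ℝ) * τ ≤ α * (-m / 2) * ‖x‖ ^ (-α - 2) * τ := by gcongr
    _ = -m / 2 * (τ * α * ‖x‖ ^ (-α - 2)) := by ring
    _ ≤ _ := mul_le_mul_of_nonneg_left (le_wtSlope hm) hm'

lemma abs_inv_wtSlope_le (hα : 0 < α) (hτ : 0 < τ) (hm : m ≤ 0) (hx : x ≠ 0) (hx1 : ‖x‖ ≤ 1) :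
    |1 / (wtSlope α τ m x * ‖x‖ ^ 2)| ≤ 1 / α / τ := by
  have hn := norm_pos_iff.2 hx
  have hk := wtSlope_pos hα hτ hm hx
  have h1 : 1 ≤ ‖x‖ ^ (-α - 2) * ‖x‖ ^ 2 := by
    rw [← Real.rpow_two, ← Real.rpow_add hn]
    exact one_le_rpow_neg hn hx1 (by linarith)
  rw [abs_of_pos (by positivity), div_div]
  refine one_div_le_one_div_of_le (by positivity) ?_
  calc α * τ ≤ α * τ * (‖x‖ ^ (-α - 2) * ‖x‖ ^ 2) := le_mul_of_one_le_right (by positivity) h1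
    _ = τ * α * ‖x‖ ^ (-α - 2) * ‖x‖ ^ 2 := by ring
    _ ≤ _ := mul_le_mul_of_nonneg_right (le_wtSlope hm) (by positivity)

/-- Carleman estimate for a second-order operator whose coefficients are close, on `U`, to
matrices for which the normalized form is positive definite. -/
lemma exists_carlemanBound {a : Fin 3 → Fin 3 → E3 → ℝ} {A0 : Fin 3 → Fin 3 → ℝ} {g c ε : ℝ}
    (hU : IsOpen U) (h0 : (0 : E3) ∉ U) (hU1 : ∀ x ∈ U, ‖x‖ ≤ 1)
    (ha : ∀ j k, ContDiffOn ℝ (⊤ : ℕ∞) (a j k) U) (hsym : ∀ j k x, a j k x = a k j x)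
    (hA : ∀ j k, A0 j k = A0 k j) (hα : 0 < α) (hc : 0 < c) (hε : 0 < ε)
    (hlow : ∀ (A : Fin 3 → Fin 3 → ℝ) (B : Fin 3 → Fin 3 → Fin 3 → ℝ)
      (h δ : ℝ), (∀ j k, |A j k - A0 j k| < ε) → (∀ i j k, |B i j k| < ε) → |h - (α + 2)| < ε →
      |δ| < ε → ∀ ω : Fin 3 → ℝ, ∑ i, ω i ^ 2 = 1 → ∀ (s : ℝ) (ξ : Fin 3 → ℝ),
      c * (s ^ 2 + ∑ i, ξ i ^ 2) ≤ scaledForm A0 α g A B h δ ω s ξ)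
    (h_a : ∀ j k, ∀ x ∈ U, |a j k x - A0 j k| < ε)
    (h_da : ∀ i j k, ∀ x ∈ U, |‖x‖ * pd i (a j k) x| < ε) {m : ℝ} (hm : m ≤ 0) :
    ∃ C > 0, ∃ τ0 ≥ 1, ∀ τ > τ0, CarlemanBound U α τ a m C := by
  have hne : ∀ x ∈ U, x ≠ 0 := fun x hx h => h0 (h ▸ hx)
  refine ⟨3 / (2 * c) * (1 / α ^ 3 + 1 / α), by positivity,
    max 1 (max (-m / 2 / ε) (1 / α / ε)), le_max_left _ _, fun τ hτ n v hv => ?_⟩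
  obtain ⟨hτ1, hτ2, hτ3⟩ : 1 < τ ∧ -m / 2 / ε < τ ∧ 1 / α / ε < τ := by
    simpa only [gt_iff_lt, max_lt_iff] using hτ
  have hτ0 : 0 < τ := by linarith
  have hW := radialWeight_wt (m := m) h0 hα hτ0 hm
  have key := hW.integral_le hU h0 ha hsym hA hc hlow h_a h_da
    (fun x hx => (abs_wtBend_sub_le hα hτ0 hm (hne x hx) (hU1 x hx)).trans_lt
      (by rwa [div_lt_comm₀ hτ0 hε]))
    (fun x hx => (abs_inv_wtSlope_le hα hτ0 hm (hne x hx) (hU1 x hx)).trans_lt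
      (by rwa [div_lt_comm₀ hτ0 hε])) hv
  have e1 : τ ^ 3 * α ^ 3 * ∫ x, wt α τ (m - 4 - 3 * α) x * v x ^ 2 ≤ ∫ x, wtSlope α τ m x ^ 3 *
      ‖x‖ ^ (2 : ℝ) * wt α (τ / 2) (m / 2) x ^ 2 * v x ^ 2 := by
    rw [← integral_const_mul]
    refine integral_le_of_le (((hv.sq hU).wt_mul hU h0).const_mul hU _) ((hv.sq hU).coef_mul hU
      (((hW.smooth_k.pow 3).mul (contDiffOn_norm_rpow h0 _)).mul (hW.smooth.pow 2))) ?_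
    intro x hx
    have hn := norm_pos_iff.2 (hne x hx)
    rw [wt_half_sq (hne x hx), ← mul_assoc]
    refine mul_le_mul_of_nonneg_right ?_ (sq_nonneg _)
    have e : wt α τ (m - 4 - 3 * α) x = (‖x‖ ^ (-α - 2)) ^ 3 * ‖x‖ ^ (2 : ℝ) * wt α τ m x := by
      rw [mul_assoc, rpow_mul_wt (hne x hx), pow_succ, pow_two, mul_assoc, mul_assoc,
        rpow_mul_wt (hne x hx), rpow_mul_wt (hne x hx), rpow_mul_wt (hne x hx)]
      congr 1
      ring
    calc _ = (τ * α * ‖x‖ ^ (-α - 2)) ^ 3 * ‖x‖ ^ (2 : ℝ) * wt α τ m x := by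
          rw [e]
          ring
      _ ≤ _ := by
          gcongr
          · exact wt_nonneg
          · exact le_wtSlope hm
  have e2 : τ * α * ∫ x, wt α τ (m - 2 - α) x * sqJet 1 v x ≤
      ∫ x, wtSlope α τ m x * wt α (τ / 2) (m / 2) x ^ 2 * sqJet 1 v x := by
    rw [← integral_const_mul]
    refine integral_le_of_le (((hv.sqJet hU 1).wt_mul hU h0).const_mul hU _)
      ((hv.sqJet hU 1).coef_mul hU (hW.smooth_k.mul (hW.smooth.pow 2))) ?_
    intro x hx
    rw [wt_half_sq (hne x hx), ← mul_assoc]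
    refine mul_le_mul_of_nonneg_right ?_ (sqJet_nonneg _ _ _)
    have e : wt α τ (m - 2 - α) x = ‖x‖ ^ (-α - 2) * wt α τ m x := by
      rw [rpow_mul_wt (hne x hx)]
      congr 1
      ring
    rw [e, ← mul_assoc]
    exact mul_le_mul_of_nonneg_right (le_wtSlope hm) wt_nonneg
  have e3 : ∫ x, wt α (τ / 2) (m / 2) x ^ 2 * op2 a v x ^ 2 = ∫ x, wt α τ m x * op2 a v x ^ 2 := by
    congr 1
    ext x
    by_cases hx : x ∈ U
    · rw [wt_half_sq (hne x hx)]
    · rw [(hv.op2 hU ha).eq_zero hx]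
      simp
  rw [e3] at key
  have hτn : 0 < τ ^ n := zpow_pos hτ0 n
  rw [wInt, wInt, wInt, zpow_add₀ hτ0.ne', zpow_add₀ hτ0.ne', zpow_one]
  have hI1 : 0 ≤ ∫ x, wt α τ (m - 4 - 3 * α) x * v x ^ 2 :=
    integral_nonneg fun x => mul_nonneg wt_nonneg (sq_nonneg _)
  have hI2 : 0 ≤ ∫ x, wt α τ (m - 2 - α) x * sqJet 1 v x :=
    integral_nonneg fun x => mul_nonneg wt_nonneg (sqJet_nonneg _ _ _)
  generalize (∫ x, wt α τ (m - 4 - 3 * α) x * v x ^ 2) = I1 at e1 hI1 ⊢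
  generalize (∫ x, wt α τ (m - 2 - α) x * sqJet 1 v x) = I2 at e2 hI2 ⊢
  generalize (∫ x, wt α τ m x * op2 a v x ^ 2) = R at key ⊢
  have hz : τ ^ (3 : ℤ) = τ ^ 3 := by norm_cast
  have hJ1 : 0 ≤ τ ^ 3 * α ^ 3 * I1 := by positivity
  have hJ2 : 0 ≤ τ * α * I2 := by positivity
  have k1 : τ ^ 3 * I1 ≤ 3 / (2 * c) * R * (1 / α ^ 3) := by
    rw [mul_one_div, le_div_iff₀ (by positivity)]
    linarith
  have k2 : τ * I2 ≤ 3 / (2 * c) * R * (1 / α) := by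
    rw [mul_one_div, le_div_iff₀ (by positivity)]
    linarith
  have k3 := mul_le_mul_of_nonneg_left (add_le_add k1 k2) hτn.le
  rw [hz]
  linarith

end ConcreteWeights

section Product

variable {U : Set E3} {α τ : ℝ} {a b : Fin 3 → Fin 3 → E3 → ℝ}

lemma CarlemanBound.mono {m C C' : ℝ} (h : CarlemanBound U α τ a m C) (hτ : 0 ≤ τ) (hC : C ≤ C') :
    CarlemanBound U α τ a m C' := fun n v hv =>
  (h n v hv).trans (mul_le_mul_of_nonneg_right hC (wInt_nonneg hτ fun _ => sq_nonneg _))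

lemma EllipticBound.mono {p C C' : ℝ} (h : EllipticBound U α τ a p C) (hτ : 0 ≤ τ) (hC : C ≤ C') :
    EllipticBound U α τ a p C' := fun n v hv =>
  (h n v hv).trans (mul_le_mul_of_nonneg_right hC (add_nonneg
    (wInt_nonneg hτ fun _ => sq_nonneg _) (wInt_nonneg hτ fun _ => sqJet_nonneg _ _ _)))

lemma pd_op2 (hU : IsOpen U) (ha : ∀ j k, ContDiffOn ℝ (⊤ : ℕ∞) (a j k) U) {u : E3 → ℝ}
    (hu : IsTest U u) (i : Fin 3) {x : E3} (hx : x ∈ U) :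
    pd i (op2 a u) x = op2 (fun j k => pd i (a j k)) u x + op2 a (pd i u) x := by
  have da : ∀ j k, DifferentiableAt ℝ (a j k) x :=
    fun j k => (ha j k).differentiableAt_of_isOpen hU hx
  have du : ∀ j k, DifferentiableAt ℝ (pd j (pd k u)) x := fun j k =>
    ((hu.pd k).pd j).differentiableAt
  change pd i (fun x => ∑ j, ∑ k, a j k x * pd j (pd k u) x) x = _
  rw [pd_sum _ (fun j x => ∑ k, a j k x * pd j (pd k u) x) i fun j _ =>
    DifferentiableAt.fun_sum fun k _ => (da j k).mul (du j k)]
  simp only [op2]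
  rw [← sum_add_distrib]
  refine sum_congr rfl fun j _ => ?_
  rw [pd_sum _ (fun k x => a j k x * pd j (pd k u) x) i fun k _ => (da j k).mul (du j k),
    ← sum_add_distrib]
  refine sum_congr rfl fun k _ => ?_
  have c : pd k (pd i u) = pd i (pd k u) := funext fun y => hu.pd_comm k i
  rw [pd_mul i (da j k) (du j k), (hu.pd k).pd_comm i j, c]

lemma sq_op2_le {u : E3 → ℝ} {x : E3} {M : ℝ} (hb : ∀ j k, |b j k x| ≤ M) :
    op2 b u x ^ 2 ≤ 9 * M ^ 2 * sqJet 2 u x := by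
  have h1 : op2 b u x = ∑ p : Fin 3 × Fin 3, b p.1 p.2 x * pd p.1 (pd p.2 u) x := by
    rw [op2, Fintype.sum_prod_type]
  have h2 : sqJet 2 u x = ∑ p : Fin 3 × Fin 3, pd p.1 (pd p.2 u) x ^ 2 := by
    rw [Fintype.sum_prod_type, sum_comm]
    rfl
  have h3 : ∑ p : Fin 3 × Fin 3, b p.1 p.2 x ^ 2 ≤ 9 * M ^ 2 := by
    refine (sum_le_sum fun p _ => sq_le_sq.2 ((hb p.1 p.2).trans (le_abs_self M))).trans ?_
    simp
  rw [h1]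
  refine (sum_mul_sq_le_sq_mul_sq _ _ _).trans ?_
  rw [← h2]
  exact mul_le_mul_of_nonneg_right h3 (sqJet_nonneg _ _ _)

lemma sq_op2_pd_le {c0 M : ℝ} (hU : IsOpen U) (ha : EllipticCoef U a c0 M) {v : E3 → ℝ}
    (hv : IsTest U v) (i : Fin 3) {x : E3} (hx : x ∈ U) :
    op2 a (pd i v) x ^ 2 ≤ 2 * sqJet 1 (op2 a v) x + 18 * M ^ 2 * sqJet 2 v x := by
  have h1 := pd_op2 hU ha.smooth hv i hx
  have h2 := sq_op2_le (u := v) (b := fun j k => pd i (a j k)) (x := x) (M := M)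
    fun j k => ha.bound_pd i j k x hx
  have h3 := sq_pd_le (op2 a v) i x
  have h4 : op2 a (pd i v) x = pd i (op2 a v) x - op2 (fun j k => pd i (a j k)) v x := by linarith
  rw [h4]
  nlinarith [sq_nonneg (pd i (op2 a v) x + op2 (fun j k => pd i (a j k)) v x)]

lemma sq_op2_pd_pd_le {c0 M : ℝ} (hU : IsOpen U) (ha : EllipticCoef U a c0 M) {v : E3 → ℝ}
    (hv : IsTest U v) (l i : Fin 3) {x : E3} (hx : x ∈ U) :
    op2 a (pd l (pd i v)) x ^ 2 ≤
      4 * sqJet 2 (op2 a v) x + 36 * M ^ 2 * sqJet 2 v x + 72 * M ^ 2 * sqJet 3 v x := by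
  have hev : pd i (op2 a v) =ᶠ[nhds x]
      fun y => op2 (fun j k => pd i (a j k)) v y + op2 a (pd i v) y := by
    filter_upwards [hU.mem_nhds hx] with y hy using pd_op2 hU ha.smooth hv i hy
  have hda : ∀ j k, ContDiffOn ℝ (⊤ : ℕ∞) (pd i (a j k)) U := fun j k => (ha.smooth j k).pd hU i
  have h1 := hev.pd_eq l
  rw [pd_add l (hv.op2 hU hda).differentiableAt ((hv.pd i).op2 hU ha.smooth).differentiableAt,
    pd_op2 hU hda hv l hx, pd_op2 hU ha.smooth (hv.pd i) l hx] at h1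
  have t1 := sq_pd_pd_le (op2 a v) l i x
  have t2 := sq_op2_le (u := v) (b := fun j k => pd l (pd i (a j k))) (x := x) (M := M)
    fun j k => ha.bound_pd_pd l i j k x hx
  have t3 := sq_op2_le (u := pd l v) (b := fun j k => pd i (a j k)) (x := x) (M := M)
    fun j k => ha.bound_pd i j k x hx
  have t4 := sq_op2_le (u := pd i v) (b := fun j k => pd l (a j k)) (x := x) (M := M)
    fun j k => ha.bound_pd l j k x hx
  have t5 := mul_le_mul_of_nonneg_left (sqJet_pd_le 2 v l x) (by positivity : 0 ≤ 9 * M ^ 2)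
  have t6 := mul_le_mul_of_nonneg_left (sqJet_pd_le 2 v i x) (by positivity : 0 ≤ 9 * M ^ 2)
  generalize op2 (fun j k => pd l (pd i (a j k))) v x = A at h1 t2
  generalize op2 (fun j k => pd i (a j k)) (pd l v) x = B at h1 t3
  generalize op2 (fun j k => pd l (a j k)) (pd i v) x = D at h1 t4
  generalize pd l (pd i (op2 a v)) x = E at h1 t1
  have h4 : op2 a (pd l (pd i v)) x = E - A - B - D := by linarith
  rw [h4]
  nlinarith [sq_nonneg (E + A), sq_nonneg (E + B), sq_nonneg (E + D), sq_nonneg (A - B),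
    sq_nonneg (A - D), sq_nonneg (B - D)]

/-- The constant in the Carleman estimate for a product of two operators. -/
def productConst (C M : ℝ) : ℝ :=
  C ^ 2 + C * (C + C ^ 2) + 3 * C * (2 * C + (18 * M ^ 2 + 1) * (C * (C + C ^ 2))) +
  9 * C * (4 * (C * (1 + C)) + 36 * M ^ 2 * (C * (C + C ^ 2)) +
    (72 * M ^ 2 + 1) * (3 * C * (2 * C + (18 * M ^ 2 + 1) * (C * (C + C ^ 2)))))

/-- Carleman estimate for a product of two second-order operators. -/
lemma product_carleman {a1 a2 : Fin 3 → Fin 3 → E3 → ℝ} {C c0 M : ℝ} (hU : IsOpen U)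
    (h0 : (0 : E3) ∉ U) (hU1 : ∀ x ∈ U, ‖x‖ ≤ 1) (hα : 0 < α) (hτ : 1 ≤ τ) (hC : 0 < C)
    (ha1 : EllipticCoef U a1 c0 M) (ha2 : ∀ j k, ContDiffOn ℝ (⊤ : ℕ∞) (a2 j k) U)
    (hc2 : CarlemanBound U α τ a2 0 C) (he2 : EllipticBound U α τ a2 α C)
    (hc1 : CarlemanBound U α τ a1 (-4 - 3 * α) C) (he1 : EllipticBound U α τ a1 (-4 - 2 * α) C)
    (he1' : EllipticBound U α τ a1 (-2) C) (he1'' : EllipticBound U α τ a1 (2 * α) C)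
    {v : E3 → ℝ} (hv : IsTest U v) :
    wInt α τ (-8 - 6 * α) 6 (sqJet 0 v) + wInt α τ (-6 - 4 * α) 4 (sqJet 1 v) +
      wInt α τ (-4 - 2 * α) 2 (sqJet 2 v) + wInt α τ (-2) 0 (sqJet 3 v) +
      wInt α τ (2 * α) (-2) (sqJet 4 v) ≤
    productConst C M * wInt α τ 0 0 (fun x => op2 a2 (op2 a1 v) x ^ 2) := by
  have hτ0 : 0 ≤ τ := by linarith
  set w := op2 a1 v with hw_def
  have hw : IsTest U w := hv.op2 hU ha1.smooth
  have hjet : ∀ (f : E3 → ℝ) (n : ℕ) (p : ℝ) (m : ℤ), 0 ≤ wInt α τ p m (sqJet n f) :=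
    fun f n p m => wInt_nonneg hτ0 fun _ => sqJet_nonneg _ _ _
  set R := wInt α τ 0 0 (fun x => op2 a2 w x ^ 2) with hR
  have i1 := hc2 0 w hw
  have i2 := he2 (-1) w hw
  have i3 := hc1 3 v hv
  have i4 := he1 2 v hv
  have i5 := fun i => he1' 0 (pd i v) (hv.pd i)
  have i6 := fun l i => he1'' (-2) (pd l (pd i v)) ((hv.pd i).pd l)
  simp only [← hw_def] at i3 i4
  rw [show (0 : ℝ) - 4 - 3 * α = -4 - 3 * α by ring, show (0 : ℝ) - 2 - α = -2 - α by ring,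
    show (0 : ℤ) + 3 = 3 by norm_num, show (0 : ℤ) + 1 = 1 by norm_num, ← hR] at i1
  rw [show α - 2 * α - 2 = -2 - α by ring, show (-1 : ℤ) + 2 = 1 by norm_num] at i2
  rw [show (-4 - 3 * α) - 4 - 3 * α = -8 - 6 * α by ring,
    show (-4 - 3 * α) - 2 - α = -6 - 4 * α by ring, show (3 : ℤ) + 3 = 6 by norm_num,
    show (3 : ℤ) + 1 = 4 by norm_num] at i3
  rw [show (-4 - 2 * α) - 2 * α - 2 = -6 - 4 * α by ring, show (2 : ℤ) + 2 = 4 by norm_num] at i4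
  simp only [show (-2 : ℝ) - 2 * α - 2 = -4 - 2 * α by ring, show (0 : ℤ) + 2 = 2 by norm_num] at i5
  simp only [show 2 * α - 2 * α - 2 = (-2 : ℝ) by ring, show (-2 : ℤ) + 2 = 0 by norm_num] at i6
  have j2 : wInt α τ α (-1) (fun x => op2 a2 w x ^ 2) ≤ R :=
    wInt_weight_mono hU h0 hU1 hτ hα.le (by norm_num) ((hw.op2 hU ha2).sq hU) fun _ => sq_nonneg _
  have j4 : wInt α τ (-4 - 2 * α) 2 (fun x => w x ^ 2) ≤
      wInt α τ (-4 - 3 * α) 3 (fun x => w x ^ 2) :=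
    wInt_weight_mono hU h0 hU1 hτ (by linarith) (by norm_num) (hw.sq hU) fun _ => sq_nonneg _
  have m1 : wInt α τ (-2) 0 (sqJet 1 w) ≤ wInt α τ (-2 - α) 1 (sqJet 1 w) :=
    wInt_weight_mono hU h0 hU1 hτ (by linarith) (by norm_num) (hw.sqJet hU 1)
      fun _ => sqJet_nonneg _ _ _
  have m2 : wInt α τ (-2) 0 (sqJet 2 v) ≤ wInt α τ (-4 - 2 * α) 2 (sqJet 2 v) :=
    wInt_weight_mono hU h0 hU1 hτ (by linarith) (by norm_num) (hv.sqJet hU 2)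
      fun _ => sqJet_nonneg _ _ _
  have m3 : wInt α τ (2 * α) (-2) (sqJet 2 w) ≤ wInt α τ α (-1) (sqJet 2 w) :=
    wInt_weight_mono hU h0 hU1 hτ (by linarith) (by norm_num) (hw.sqJet hU 2)
      fun _ => sqJet_nonneg _ _ _
  have m4 : wInt α τ (2 * α) (-2) (sqJet 2 v) ≤ wInt α τ (-4 - 2 * α) 2 (sqJet 2 v) :=
    wInt_weight_mono hU h0 hU1 hτ (by linarith) (by norm_num) (hv.sqJet hU 2)
      fun _ => sqJet_nonneg _ _ _
  have m5 : wInt α τ (2 * α) (-2) (sqJet 3 v) ≤ wInt α τ (-2) 0 (sqJet 3 v) :=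
    wInt_weight_mono hU h0 hU1 hτ (by linarith) (by norm_num) (hv.sqJet hU 3)
      fun _ => sqJet_nonneg _ _ _
  have j5 : ∀ i, wInt α τ (-2) 0 (fun x => op2 a1 (pd i v) x ^ 2) ≤
      2 * wInt α τ (-2) 0 (sqJet 1 w) + 18 * M ^ 2 * wInt α τ (-2) 0 (sqJet 2 v) := by
    intro i
    rw [← wInt_const_mul, ← wInt_const_mul, ← wInt_add hU h0 ((hw.sqJet hU 1).const_mul hU _)
      ((hv.sqJet hU 2).const_mul hU _)]
    exact wInt_mono hU h0 hτ0 (((hv.pd i).op2 hU ha1.smooth).sq hU)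
      (((hw.sqJet hU 1).const_mul hU _).add ((hv.sqJet hU 2).const_mul hU _))
      fun x hx => sq_op2_pd_le hU ha1 hv i hx
  have j5' : ∀ i, wInt α τ (-4 - 2 * α) 2 (sqJet 1 (pd i v)) ≤
      wInt α τ (-4 - 2 * α) 2 (sqJet 2 v) := fun i =>
    wInt_mono hU h0 hτ0 ((hv.pd i).sqJet hU 1) (hv.sqJet hU 2) fun x _ => sqJet_pd_le 1 v i x
  have j6 : ∀ l i, wInt α τ (2 * α) (-2) (fun x => op2 a1 (pd l (pd i v)) x ^ 2) ≤
      4 * wInt α τ (2 * α) (-2) (sqJet 2 w) + 36 * M ^ 2 * wInt α τ (2 * α) (-2) (sqJet 2 v) +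
      72 * M ^ 2 * wInt α τ (2 * α) (-2) (sqJet 3 v) := by
    intro l i
    have u1 := (hw.sqJet hU 2).const_mul hU 4
    have u2 := (hv.sqJet hU 2).const_mul hU (36 * M ^ 2)
    have u3 := (hv.sqJet hU 3).const_mul hU (72 * M ^ 2)
    rw [← wInt_const_mul, ← wInt_const_mul, ← wInt_const_mul, ← wInt_add hU h0 u1 u2,
      ← wInt_add hU h0 (u1.add u2) u3]
    exact wInt_mono hU h0 hτ0 ((((hv.pd i).pd l).op2 hU ha1.smooth).sq hU) ((u1.add u2).add u3)
      fun x hx => sq_op2_pd_pd_le hU ha1 hv l i hx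
  have j6' : ∀ l i, wInt α τ (-2) 0 (sqJet 1 (pd l (pd i v))) ≤ wInt α τ (-2) 0 (sqJet 3 v) :=
    fun l i => wInt_mono hU h0 hτ0 (((hv.pd i).pd l).sqJet hU 1) (hv.sqJet hU 3) fun x _ =>
      (sqJet_pd_le 1 (pd i v) l x).trans (sqJet_pd_le 2 v i x)
  have s3 : wInt α τ (-2) 0 (sqJet 3 v) = ∑ i, wInt α τ (-2) 0 (sqJet 2 (pd i v)) :=
    wInt_sum hU h0 univ fun i _ => (hv.pd i).sqJet hU 2
  have s4 : wInt α τ (2 * α) (-2) (sqJet 4 v) =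
      ∑ i, ∑ l, wInt α τ (2 * α) (-2) (sqJet 2 (pd l (pd i v))) := by
    refine (wInt_sum hU h0 univ fun i _ => (hv.pd i).sqJet hU 3).trans (sum_congr rfl fun i _ => ?_)
    exact wInt_sum hU h0 univ fun l _ => ((hv.pd i).pd l).sqJet hU 2
  have hW0 : 0 ≤ wInt α τ (-4 - 3 * α) 3 (fun x => w x ^ 2) := wInt_nonneg hτ0 fun _ => sq_nonneg _
  have hV0 : 0 ≤ wInt α τ (-8 - 6 * α) 6 (fun x => v x ^ 2) := wInt_nonneg hτ0 fun _ => sq_nonneg _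
  have hW1 := hjet w 1 (-2 - α) 1
  have hV1 := hjet v 1 (-6 - 4 * α) 4
  change wInt α τ (-8 - 6 * α) 6 (fun x => v x ^ 2) + _ + _ + _ + _ ≤ _
  generalize wInt α τ (-8 - 6 * α) 6 (fun x => v x ^ 2) = V0 at *
  generalize wInt α τ (-4 - 3 * α) 3 (fun x => w x ^ 2) = W0 at *
  generalize wInt α τ (-2 - α) 1 (sqJet 1 w) = W1 at *
  generalize wInt α τ (-6 - 4 * α) 4 (sqJet 1 v) = V1 at *
  generalize wInt α τ (-4 - 2 * α) 2 (sqJet 2 v) = V2 at *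
  generalize wInt α τ α (-1) (sqJet 2 w) = W2 at *
  have b0 : W0 ≤ C * R := by linarith
  have b1 : W1 ≤ C * R := by linarith
  have b2 : W2 ≤ C * (1 + C) * R := by
    calc W2 ≤ C * (R + C * R) := i2.trans (by gcongr)
      _ = _ := by ring
  have bV : V0 + V1 ≤ C ^ 2 * R := by
    calc V0 + V1 ≤ C * (C * R) := i3.trans (by gcongr)
      _ = _ := by ring
  have bV2 : V2 ≤ C * (C + C ^ 2) * R := by
    calc V2 ≤ C * (C * R + C ^ 2 * R) := i4.trans (by gcongr <;> linarith)
      _ = _ := by ring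
  set V3 := wInt α τ (-2) 0 (sqJet 3 v) with hV3
  have bV3 : V3 ≤ 3 * C * (2 * C + (18 * M ^ 2 + 1) * (C * (C + C ^ 2))) * R := by
    have : ∀ i, wInt α τ (-2) 0 (sqJet 2 (pd i v)) ≤
        C * ((2 * (C * R) + 18 * M ^ 2 * (C * (C + C ^ 2) * R)) + C * (C + C ^ 2) * R) := by
      intro i
      refine (i5 i).trans ?_
      gcongr
      · refine (j5 i).trans ?_
        gcongr
        · exact m1.trans b1
        · exact m2.trans bV2
      · exact (j5' i).trans bV2
    calc V3 ≤ ∑ i : Fin 3, _ := s3.le.trans (sum_le_sum fun i _ => this i)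
      _ = _ := by
        rw [sum_const, card_univ, Fintype.card_fin, nsmul_eq_mul]
        push_cast
        ring
  set K3 := 3 * C * (2 * C + (18 * M ^ 2 + 1) * (C * (C + C ^ 2))) with hK3
  have bV4 : wInt α τ (2 * α) (-2) (sqJet 4 v) ≤ 9 * C * (4 * (C * (1 + C)) +
      36 * M ^ 2 * (C * (C + C ^ 2)) + (72 * M ^ 2 + 1) * K3) * R := by
    have : ∀ i l, wInt α τ (2 * α) (-2) (sqJet 2 (pd l (pd i v))) ≤
        C * ((4 * (C * (1 + C) * R) + 36 * M ^ 2 * (C * (C + C ^ 2) * R) +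
          72 * M ^ 2 * (K3 * R)) + K3 * R) := by
      intro i l
      refine (i6 l i).trans ?_
      gcongr
      · refine (j6 l i).trans ?_
        gcongr
        · exact m3.trans b2
        · exact m4.trans bV2
        · exact m5.trans bV3
      · exact (j6' l i).trans bV3
    calc wInt α τ (2 * α) (-2) (sqJet 4 v) ≤ ∑ i : Fin 3, ∑ l : Fin 3, _ :=
          s4.le.trans (sum_le_sum fun i _ => sum_le_sum fun l _ => this i l)
      _ = _ := by
        simp only [sum_const, card_univ, Fintype.card_fin, nsmul_eq_mul]
        push_cast
        ring
  calc _ ≤ C ^ 2 * R + C * (C + C ^ 2) * R + K3 * R + 9 * C * (4 * (C * (1 + C)) +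
      36 * M ^ 2 * (C * (C + C ^ 2)) + (72 * M ^ 2 + 1) * K3) * R := by linarith
    _ = _ := by
      rw [productConst, ← hK3]
      ring

end Product

lemma exists_eventually_abs_le {ι : Type*} [Fintype ι] {F : ι → E3 → ℝ} {x : E3}
    (hF : ∀ i, ContinuousAt (F i) x) : ∃ M, ∀ᶠ y in nhds x, ∀ i, |F i y| ≤ M := by
  have h : ContinuousAt (fun y i => F i y) x := continuousAt_pi.2 hF
  refine ⟨‖fun i => F i x‖ + 1, ?_⟩
  filter_upwards [h.norm.eventually_lt_const (lt_add_one _)] with y hy i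
  exact (norm_le_pi_norm (fun i => F i y) i).trans hy.le

section Local

variable {Ω : Set E3} {α : ℝ} {a : Fin 3 → Fin 3 → E3 → ℝ}

lemma exists_local_bounds (hΩ : IsOpen Ω) (h0 : (0 : E3) ∈ Ω)
    (ha : ∀ j k, ContDiffOn ℝ (⊤ : ℕ∞) (a j k) Ω) {ε : ℝ} (hε : 0 < ε) :
    ∃ M, ∃ r > 0, ∀ x ∈ ball (0 : E3) r, x ∈ Ω ∧ ‖x‖ ≤ 1 ∧
      (∀ j k, |a j k x - a j k 0| < ε) ∧ (∀ i j k, |‖x‖ * pd i (a j k) x| < ε) ∧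
      (∀ j k, |a j k x| ≤ M) ∧ (∀ i j k, |pd i (a j k) x| ≤ M) ∧
      ∀ i l j k, |pd i (pd l (a j k)) x| ≤ M := by
  have hΩ0 := hΩ.mem_nhds h0
  have hc0 : ∀ j k, ContinuousAt (a j k) 0 := fun j k => (ha j k).continuousOn.continuousAt hΩ0
  have hc1 : ∀ i j k, ContinuousAt (pd i (a j k)) 0 := fun i j k =>
    ((ha j k).pd hΩ i).continuousOn.continuousAt hΩ0
  have hc2 : ∀ i l j k, ContinuousAt (pd i (pd l (a j k))) 0 := fun i l j k =>
    (((ha j k).pd hΩ l).pd hΩ i).continuousOn.continuousAt hΩ0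
  obtain ⟨M0, hM0⟩ := exists_eventually_abs_le (F := fun p : Fin 3 × Fin 3 => a p.1 p.2)
    fun p => hc0 _ _
  obtain ⟨M1, hM1⟩ := exists_eventually_abs_le
    (F := fun p : Fin 3 × Fin 3 × Fin 3 => pd p.1 (a p.2.1 p.2.2)) fun p => hc1 _ _ _
  obtain ⟨M2, hM2⟩ := exists_eventually_abs_le
    (F := fun p : Fin 3 × Fin 3 × Fin 3 × Fin 3 => pd p.1 (pd p.2.1 (a p.2.2.1 p.2.2.2)))
    fun p => hc2 _ _ _ _
  have he0 : ∀ᶠ x in nhds (0 : E3), ∀ j k, |a j k x - a j k 0| < ε := by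
    refine Filter.eventually_all.2 fun j => Filter.eventually_all.2 fun k => ?_
    have h : ContinuousAt (fun x => |a j k x - a j k 0|) 0 :=
      ((hc0 j k).sub continuousAt_const).abs
    exact h.eventually_lt_const (by simpa using hε)
  have he1 : ∀ᶠ x in nhds (0 : E3), ∀ i j k, |‖x‖ * pd i (a j k) x| < ε := by
    refine Filter.eventually_all.2 fun i => Filter.eventually_all.2 fun j =>
      Filter.eventually_all.2 fun k => ?_
    have h : ContinuousAt (fun x : E3 => |‖x‖ * pd i (a j k) x|) 0 :=
      (continuous_norm.continuousAt.mul (hc1 i j k)).abs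
    exact h.eventually_lt_const (by simpa using hε)
  have he2 : ∀ᶠ x in nhds (0 : E3), ‖x‖ < 1 :=
    continuous_norm.continuousAt.eventually_lt_const (by simp)
  have hall := he0.and (he1.and (he2.and (hM0.and (hM1.and (hM2.and hΩ0)))))
  obtain ⟨r, hr, hball⟩ := Metric.eventually_nhds_iff_ball.1 hall
  refine ⟨max M0 (max M1 M2), r, hr, fun x hx => ?_⟩
  obtain ⟨h1, h2, h3, h4, h5, h6, h7⟩ := hball x hx
  exact ⟨h7, h3.le, h1, h2, fun j k => (h4 (j, k)).trans (le_max_left _ _),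
    fun i j k => (h5 (i, j, k)).trans ((le_max_left _ _).trans (le_max_right _ _)),
    fun i l j k => (h6 (i, l, j, k)).trans ((le_max_right _ _).trans (le_max_right _ _))⟩

/-- On small punctured neighbourhoods of the origin, an elliptic operator with the eigenvalue gap
condition satisfies the first-order Carleman estimate and the weighted elliptic estimate. -/
lemma exists_local_estimates (hΩ : IsOpen Ω) (h0 : (0 : E3) ∈ Ω) (hα : 0 < α)
    (ha : ∀ j k, ContDiffOn ℝ (⊤ : ℕ∞) (a j k) Ω) (hsym : ∀ j k x, a j k x = a k j x)
    (hell : UnifElliptic a Ω) (heig : EigCond a α) :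
    ∃ r > 0, ∃ c0 M : ℝ, ∀ U ⊆ ball (0 : E3) r, IsOpen U → (0 : E3) ∉ U →
      (∀ x ∈ U, ‖x‖ ≤ 1) ∧ EllipticCoef U a c0 M ∧
      (∀ m ≤ 0, ∃ C > 0, ∃ τ0 ≥ 1, ∀ τ > τ0, CarlemanBound U α τ a m C) ∧
      ∀ p, ∃ C > 0, ∀ τ ≥ 1, EllipticBound U α τ a p C := by
  obtain ⟨c0, hc0, hell⟩ := hell
  obtain ⟨l1, l3, h1, h3, hgap, hspec⟩ :=
    exists_spectral_bounds hc0 (fun j k => hsym j k 0) (hell 0 h0) heig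
  obtain ⟨g, c, ε, hc, hε, hlow⟩ := exists_scaledForm_lower_bound (A0 := fun j k => a j k 0)
    (fun j k => hsym j k 0) hα h1 h3 hgap hspec
  obtain ⟨M, r, hr, hb⟩ := exists_local_bounds hΩ h0 ha hε
  refine ⟨r, hr, c0, M, fun U hUr hU h0U => ?_⟩
  replace hb := fun x hx => hb x (hUr hx)
  have hU1 : ∀ x ∈ U, ‖x‖ ≤ 1 := fun x hx => (hb x hx).2.1
  have haU : ∀ j k, ContDiffOn ℝ (⊤ : ℕ∞) (a j k) U := fun j k =>
    (ha j k).mono fun x hx => (hb x hx).1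
  have hE : EllipticCoef U a c0 M :=
    { smooth := haU
      symm := hsym
      elliptic := fun x hx => hell x (hb x hx).1
      bound := fun j k x hx => (hb x hx).2.2.2.2.1 j k
      bound_pd := fun i j k x hx => (hb x hx).2.2.2.2.2.1 i j k
      bound_pd_pd := fun i l j k x hx => (hb x hx).2.2.2.2.2.2 i l j k }
  exact ⟨hU1, hE, fun m hm => exists_carlemanBound hU h0U hU1 haU hsym (fun j k => hsym j k 0)
    hα hc hε hlow (fun j k x hx => (hb x hx).2.2.1 j k)
    (fun i j k x hx => (hb x hx).2.2.2.1 i j k) hm,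
    fun p => hE.exists_ellipticBound hU h0U hU1 hc0 hα p⟩

/-- The scalar fourth-order Carleman estimate. -/
lemma exists_scalar_carleman {a1 a2 : Fin 3 → Fin 3 → E3 → ℝ} (hΩ : IsOpen Ω)
    (h0 : (0 : E3) ∈ Ω) (hα : 0 < α)
    (ha1 : ∀ j k, ContDiffOn ℝ (⊤ : ℕ∞) (a1 j k) Ω) (hsym1 : ∀ j k x, a1 j k x = a1 k j x)
    (hell1 : UnifElliptic a1 Ω) (heig1 : EigCond a1 α)
    (ha2 : ∀ j k, ContDiffOn ℝ (⊤ : ℕ∞) (a2 j k) Ω) (hsym2 : ∀ j k x, a2 j k x = a2 k j x)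
    (hell2 : UnifElliptic a2 Ω) (heig2 : EigCond a2 α) :
    ∃ r > 0, (∀ j k, ContDiffOn ℝ (⊤ : ℕ∞) (a1 j k) (ball 0 r \ {0})) ∧
      (∀ j k, ContDiffOn ℝ (⊤ : ℕ∞) (a2 j k) (ball 0 r \ {0})) ∧
      ∃ K > 0, ∃ τ0 > 0, ∀ τ > τ0, ∀ v, IsTest (ball 0 r \ {0}) v →
      wInt α τ (-8 - 6 * α) 6 (sqJet 0 v) + wInt α τ (-6 - 4 * α) 4 (sqJet 1 v) +
      wInt α τ (-4 - 2 * α) 2 (sqJet 2 v) + wInt α τ (-2) 0 (sqJet 3 v) +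
      wInt α τ (2 * α) (-2) (sqJet 4 v) ≤
      K * wInt α τ 0 0 (fun x => op2 a2 (op2 a1 v) x ^ 2) := by
  obtain ⟨r1, hr1, c1, M, H1⟩ := exists_local_estimates hΩ h0 hα ha1 hsym1 hell1 heig1
  obtain ⟨r2, hr2, c2, M2, H2⟩ := exists_local_estimates hΩ h0 hα ha2 hsym2 hell2 heig2
  set U : Set E3 := ball 0 (min r1 r2) \ {0} with hUdef
  have hU : IsOpen U := isOpen_ball.sdiff isClosed_singleton
  have h0U : (0 : E3) ∉ U := by simp [hUdef]
  obtain ⟨hU1, hE1, hC1, hEl1⟩ :=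
    H1 U (Set.sdiff_subset.trans (ball_subset_ball (min_le_left _ _))) hU h0U
  obtain ⟨-, hE2, hC2, hEl2⟩ :=
    H2 U (Set.sdiff_subset.trans (ball_subset_ball (min_le_right _ _))) hU h0U
  obtain ⟨A1, hA1, t1, ht1, B1⟩ := hC2 0 le_rfl
  obtain ⟨A2, hA2, B2⟩ := hEl2 α
  obtain ⟨A3, hA3, t3, ht3, B3⟩ := hC1 (-4 - 3 * α) (by linarith)
  obtain ⟨A4, hA4, B4⟩ := hEl1 (-4 - 2 * α)
  obtain ⟨A5, hA5, B5⟩ := hEl1 (-2)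
  obtain ⟨A6, hA6, B6⟩ := hEl1 (2 * α)
  refine ⟨min r1 r2, lt_min hr1 hr2, hE1.smooth, hE2.smooth,
    productConst (A1 + A2 + A3 + A4 + A5 + A6) M, by unfold productConst; positivity,
    max t1 t3, by positivity, fun τ hτ v hv => ?_⟩
  obtain ⟨hτ1, hτ3⟩ := max_lt_iff.1 hτ
  have hτ : 1 ≤ τ := by linarith
  have hτ0 : 0 ≤ τ := by linarith
  exact product_carleman hU h0U hU1 hα hτ (by positivity) hE1 hE2.smooth
    ((B1 τ hτ1).mono hτ0 (by linarith)) ((B2 τ hτ).mono hτ0 (by linarith))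
    ((B3 τ hτ3).mono hτ0 (by linarith)) ((B4 τ hτ).mono hτ0 (by linarith))
    ((B5 τ hτ).mono hτ0 (by linarith)) ((B6 τ hτ).mono hτ0 (by linarith)) hv

end Local

lemma sq_norm_iteratedFDeriv_sum_smul_le {E F ι : Type*} [NormedAddCommGroup E] [NormedSpace ℝ E]
    [NormedAddCommGroup F] [NormedSpace ℝ F] [Fintype ι] {g : ι → E → ℝ} {e : ι → F}
    (hg : ∀ i, ContDiff ℝ (⊤ : ℕ∞) (g i)) (he : ∀ i, ‖e i‖ ≤ 1) (n : ℕ) (x : E) :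
    ‖iteratedFDeriv ℝ n (fun y => ∑ i, g i y • e i) x‖ ^ 2 ≤
      Fintype.card ι * ∑ i, ‖iteratedFDeriv ℝ n (g i) x‖ ^ 2 := by
  have hn : (n : WithTop ℕ∞) ≤ ((⊤ : ℕ∞) : WithTop ℕ∞) := WithTop.coe_le_coe.2 le_top
  have hterm : ∀ i, ‖iteratedFDeriv ℝ n (fun y => g i y • e i) x‖ ≤
      ‖iteratedFDeriv ℝ n (g i) x‖ := by
    intro i
    have h := (ContinuousLinearMap.toSpanSingleton ℝ (e i)).norm_iteratedFDeriv_comp_left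
      (hg i).contDiffAt (x := x) hn
    rw [ContinuousLinearMap.norm_toSpanSingleton] at h
    exact h.trans (mul_le_of_le_one_left (norm_nonneg _) (he i))
  have hsmooth : ∀ i ∈ univ, ContDiffAt ℝ n (fun y => g i y • e i) x := fun i _ =>
    (((hg i).smul contDiff_const).of_le hn).contDiffAt
  rw [iteratedFDeriv_fun_sum_apply hsmooth]
  calc _ ≤ (∑ i, ‖iteratedFDeriv ℝ n (g i) x‖) ^ 2 := by
        gcongr
        exact norm_sum_le_of_le _ fun i _ => hterm i
    _ ≤ _ := by simpa using sq_sum_le_card_mul_sum_sq (s := univ)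
                  (f := fun i => ‖iteratedFDeriv ℝ n (g i) x‖)

lemma norm_proj_le_one (i : Fin 3) : ‖(EuclideanSpace.proj i : E3 →L[ℝ] ℝ)‖ ≤ 1 :=
  ContinuousLinearMap.opNorm_le_bound _ zero_le_one fun x => by
    simpa using abs_coord_le x i

lemma fderiv_eq_sum_pd (f : E3 → ℝ) :
    fderiv ℝ f = fun y => ∑ i, pd i f y • (EuclideanSpace.proj i : E3 →L[ℝ] ℝ) := by
  funext y
  ext v
  conv_lhs => rw [← (EuclideanSpace.basisFun (Fin 3) ℝ).sum_repr v]
  simp [pd, mul_comm]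

lemma sq_norm_iteratedFDeriv_le {f : E3 → ℝ} (hf : ContDiff ℝ (⊤ : ℕ∞) f) (n : ℕ) (x : E3) :
    ‖iteratedFDeriv ℝ n f x‖ ^ 2 ≤ 3 ^ n * sqJet n f x := by
  induction n generalizing f with
  | zero => simp [sqJet]
  | succ n ih =>
    have hpd : ∀ i, ContDiff ℝ (⊤ : ℕ∞) (pd i f) := fun i =>
      contDiffOn_univ.1 (hf.contDiffOn.pd isOpen_univ i)
    rw [← norm_iteratedFDeriv_fderiv, fderiv_eq_sum_pd]
    refine (sq_norm_iteratedFDeriv_sum_smul_le hpd norm_proj_le_one n x).trans ?_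
    have h : ∑ i, ‖iteratedFDeriv ℝ n (pd i f) x‖ ^ 2 ≤ ∑ i, 3 ^ n * sqJet n (pd i f) x :=
      sum_le_sum fun i _ => ih (hpd i)
    rw [← mul_sum] at h
    calc _ ≤ (Fintype.card (Fin 3) : ℝ) * (3 ^ n * ∑ i, sqJet n (pd i f) x) := by gcongr
      _ = _ := by
        simp only [Fintype.card_fin, sqJet]
        push_cast
        ring

lemma sq_norm_iteratedFDeriv_vector_le {V : E3 → E7} (hV : ∀ i, ContDiff ℝ (⊤ : ℕ∞) fun y => V y i)
    (n : ℕ) (x : E3) :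
    ‖iteratedFDeriv ℝ n V x‖ ^ 2 ≤ 7 * 3 ^ n * ∑ i, sqJet n (fun y => V y i) x := by
  have hsum : V = fun y => ∑ i, V y i • EuclideanSpace.single i (1 : ℝ) := by
    funext y
    ext j
    simp [Finset.sum_apply, Pi.single_apply]
  have h1 := sq_norm_iteratedFDeriv_sum_smul_le hV (e := fun i => EuclideanSpace.single i (1 : ℝ))
    (by simp) n x
  rw [← hsum] at h1
  have h2 : ∑ i, ‖iteratedFDeriv ℝ n (fun y => V y i) x‖ ^ 2 ≤
      ∑ i, 3 ^ n * sqJet n (fun y => V y i) x :=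
    sum_le_sum fun i _ => sq_norm_iteratedFDeriv_le (hV i) n x
  rw [← mul_sum] at h2
  calc _ ≤ _ := h1
    _ ≤ (Fintype.card (Fin 7) : ℝ) * (3 ^ n * ∑ i, sqJet n (fun y => V y i) x) := by gcongr
    _ = _ := by
      simp only [Fintype.card_fin]
      push_cast
      ring

lemma sq_norm_op2V (a1 a2 : Fin 3 → Fin 3 → E3 → ℝ) (V : E3 → E7) (x : E3) :
    ‖op2V a2 (op2V a1 V) x‖ ^ 2 = ∑ i, op2 a2 (op2 a1 fun y => V y i) x ^ 2 := by
  rw [EuclideanSpace.real_norm_sq_eq]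
  rfl

section Vector

variable {U : Set E3} {α τ : ℝ} {V : E3 → E7}

lemma isTest_component {r : ℝ} (hV : ContDiff ℝ (⊤ : ℕ∞) V) (hs : tsupport V ⊆ ball (0 : E3) r \ {0})
    (i : Fin 7) : IsTest (ball (0 : E3) r \ {0}) fun y => V y i := by
  have hsub : tsupport (fun y => V y i) ⊆ tsupport V :=
    closure_mono fun y hy h => hy (by simp [h])
  refine ⟨(EuclideanSpace.proj i : E7 →L[ℝ] ℝ).contDiff.comp hV, ?_, hsub.trans hs⟩
  exact Metric.isCompact_of_isClosed_isBounded (isClosed_tsupport _)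
    (isBounded_ball.subset ((hsub.trans hs).trans Set.sdiff_subset))

lemma integral_weight_iteratedFDeriv_le (hU : IsOpen U) (h0 : (0 : E3) ∉ U) (hτ : 0 ≤ τ)
    (hV : ∀ i, IsTest U fun y => V y i) (n : ℤ) (j : ℕ) {q : ℝ}
    (hq : q = -8 - 6 * α + 2 * j * (1 + α)) :
    τ ^ n * ∫ x : E3, ‖x‖ ^ (-8 - 6 * α) * ‖x‖ ^ (2 * (j : ℝ) * (1 + α))
        * Real.exp (2 * τ * ‖x‖ ^ (-α)) * ‖iteratedFDeriv ℝ j V x‖ ^ 2 ≤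
      7 * 3 ^ j * ∑ i, wInt α τ q n (sqJet j fun y => V y i) := by
  have hT : IsTest U fun x => ∑ i, sqJet j (fun y => V y i) x :=
    IsTest.sum _ fun i _ => (hV i).sqJet hU j
  have hle : ∀ x, ‖iteratedFDeriv ℝ j V x‖ ^ 2 ≤ 7 * 3 ^ j * ∑ i, sqJet j (fun y => V y i) x :=
    fun x => sq_norm_iteratedFDeriv_vector_le (fun i => (hV i).contDiff) j x
  rw [← wInt_sum hU h0 _ fun i _ => (hV i).sqJet hU j, ← wInt_const_mul]
  refine mul_le_mul_of_nonneg_left (integral_mono_of_nonneg ?_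
    ((hT.const_mul hU _).wt_mul hU h0).integrable ?_) (zpow_nonneg hτ n)
  · exact Filter.Eventually.of_forall fun x => by positivity
  · refine Filter.Eventually.of_forall fun x => ?_
    rcases eq_or_ne x 0 with rfl | hx
    · have h := hle 0
      rw [hT.eq_zero h0, mul_zero] at h
      have h' : ‖iteratedFDeriv ℝ j V 0‖ ^ 2 = 0 := le_antisymm h (sq_nonneg _)
      simp only [h', hT.eq_zero h0, mul_zero, le_refl]
    · have hw : ‖x‖ ^ (-8 - 6 * α) * ‖x‖ ^ (2 * (j : ℝ) * (1 + α)) *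
          Real.exp (2 * τ * ‖x‖ ^ (-α)) = wt α τ q x := by
        rw [wt, hq, ← Real.rpow_add (norm_pos_iff.2 hx)]
      simp only [hw]
      exact mul_le_mul_of_nonneg_left (hle x) wt_nonneg

end Vector

/-- **Carleman estimate for the product operator `P₂P₁`** (estimate (4.4)).
For uniformly elliptic `P₁, P₂` with `G^s` coefficients, eigenvalue gap `α` at
`0`, `s < 1 + 1/α`: there are `τ₀, r₀, C > 0` such that for every `τ > τ₀` and
every smooth `V : ℝ³ → ℝ⁷` compactly supported in `B(0,r₀) \ {0}`:
`Σ_{j=0}^{4} τ^{6-2j} ∫ |x|^{-8-6α}|x|^{2j(1+α)} e^{2τ|x|^{-α}} |D^j V|²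
  ≤ C ∫ e^{2τ|x|^{-α}} |P₂P₁V|²`. -/
theorem carleman_fourth_order
    (Ω : Set E3) (hΩopen : IsOpen Ω) (h0Ω : (0 : E3) ∈ Ω)
    (s α : ℝ) (hs : 1 ≤ s) (hα : 0 < α) (hsα : s < 1 + 1 / α)
    (a : Fin 2 → Fin 3 → Fin 3 → E3 → ℝ)
    (hsym : ∀ ℓ : Fin 2, ∀ j k : Fin 3, ∀ x : E3, a ℓ j k x = a ℓ k j x)
    (hG : ∀ ℓ : Fin 2, ∀ j k : Fin 3, GevreyOn s Ω (a ℓ j k))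
    (hell : ∀ ℓ : Fin 2, UnifElliptic (a ℓ) Ω)
    (heig : ∀ ℓ : Fin 2, EigCond (a ℓ) α) :
    ∃ τ0 > (0 : ℝ), ∃ r0 > (0 : ℝ), ∃ C > (0 : ℝ), ∀ τ : ℝ, τ > τ0 →
      ∀ V : E3 → E7, ContDiff ℝ (⊤ : ℕ∞) V → tsupport V ⊆ ball (0 : E3) r0 \ {0} →
        (∑ j ∈ Finset.range 5, τ ^ ((6 : ℤ) - 2 * j)
            * ∫ x : E3, ‖x‖ ^ (-8 - 6 * α) * ‖x‖ ^ (2 * (j : ℝ) * (1 + α))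
                * Real.exp (2 * τ * ‖x‖ ^ (-α)) * ‖iteratedFDeriv ℝ j V x‖ ^ 2)
        ≤ C * ∫ x : E3, Real.exp (2 * τ * ‖x‖ ^ (-α))
              * ‖op2V (a 1) (op2V (a 0) V) x‖ ^ 2 := by
  obtain ⟨r, hr, ha1, ha2, K, hK, τ0, hτ0, H⟩ := exists_scalar_carleman hΩopen h0Ω hα
    (fun j k => (hG 0 j k).1) (hsym 0) (hell 0) (heig 0)
    (fun j k => (hG 1 j k).1) (hsym 1) (hell 1) (heig 1)
  refine ⟨τ0, hτ0, r, hr, 567 * K, by positivity, fun τ hτ V hV hs => ?_⟩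
  set U : Set E3 := ball 0 r \ {0} with hUdef
  have hU : IsOpen U := isOpen_ball.sdiff isClosed_singleton
  have h0U : (0 : E3) ∉ U := by simp [hUdef]
  have hτ' : 0 ≤ τ := by linarith
  have hVi : ∀ i, IsTest U fun y => V y i := isTest_component hV hs
  have hR : ∫ x : E3, Real.exp (2 * τ * ‖x‖ ^ (-α)) * ‖op2V (a 1) (op2V (a 0) V) x‖ ^ 2 =
      ∑ i, wInt α τ 0 0 (fun x => op2 (a 1) (op2 (a 0) fun y => V y i) x ^ 2) := by
    rw [← wInt_sum hU h0U _ fun i _ => (((hVi i).op2 hU ha1).op2 hU ha2).sq hU]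
    simp only [sq_norm_op2V, wInt, wt, Real.rpow_zero, one_mul, zpow_zero]
  have hsum := sum_le_sum fun i (_ : i ∈ univ) => H τ hτ _ (hVi i)
  rw [← mul_sum, ← hR] at hsum
  simp only [sum_add_distrib] at hsum
  have hle : ∀ (n : ℤ) (j : ℕ), j ≤ 4 → ∀ q : ℝ, q = -8 - 6 * α + 2 * j * (1 + α) →
      τ ^ n * ∫ x : E3, ‖x‖ ^ (-8 - 6 * α) * ‖x‖ ^ (2 * (j : ℝ) * (1 + α))
        * Real.exp (2 * τ * ‖x‖ ^ (-α)) * ‖iteratedFDeriv ℝ j V x‖ ^ 2 ≤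
      567 * ∑ i, wInt α τ q n (sqJet j fun y => V y i) := by
    intro n j hj q hq
    refine (integral_weight_iteratedFDeriv_le hU h0U hτ' hVi n j hq).trans ?_
    refine mul_le_mul_of_nonneg_right ?_
      (sum_nonneg fun i _ => wInt_nonneg hτ' fun x => sqJet_nonneg _ _ _)
    have : (3 : ℝ) ^ j ≤ 3 ^ 4 := pow_le_pow_right₀ (by norm_num) hj
    linarith
  have t0 := hle 6 0 (by norm_num) (-8 - 6 * α) (by push_cast; ring)
  have t1 := hle 4 1 (by norm_num) (-6 - 4 * α) (by push_cast; ring)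
  have t2 := hle 2 2 (by norm_num) (-4 - 2 * α) (by push_cast; ring)
  have t3 := hle 0 3 (by norm_num) (-2) (by push_cast; ring)
  have t4 := hle (-2) 4 (by norm_num) (2 * α) (by push_cast; ring)
  simp only [sum_range_succ, sum_range_zero, zero_add]
  rw [show (6 : ℤ) - 2 * ((0 : ℕ) : ℤ) = 6 by norm_num,
    show (6 : ℤ) - 2 * ((1 : ℕ) : ℤ) = 4 by norm_num,
    show (6 : ℤ) - 2 * ((2 : ℕ) : ℤ) = 2 by norm_num,
    show (6 : ℤ) - 2 * ((3 : ℕ) : ℤ) = 0 by norm_num,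
    show (6 : ℤ) - 2 * ((4 : ℕ) : ℤ) = -2 by norm_num]
  linarith
end
end

section
/- Let Ω ⊂ ℝ³ be a connected open set containing 0, with λ, μ, ρ, t_jk ∈ C^∞(Ω), ρ > 0, T = (t_jk) symmetric with ∇·T = 0, and the operators P₁ = Σ(μδ_jk + t_jk)∂²_{jk}, P₂ = Σ((λ+2μ)δ_jk + t_jk)∂²_{jk} uniformly elliptic. Let u : Ω → ℝ³ be a smooth solution of the residual stress system ∇·σ + κ²ρu = 0 such that for every N > 0, ∫_{R ≤ |x| ≤ 2R} |u|² dx = O(R^N) as R → 0. Then for every multiindex β with |β| ≤ 2 and every N > 0, ∫_{R ≤ |x| ≤ 2R} R^{2|β|} |∂^β u|² dx = O(R^N) as R → 0. -/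
open MeasureTheory Metric Finset

noncomputable section

/-- `f` vanishes to infinite order at the origin. -/
def FlatAtZero (f : E3 → ℝ) : Prop :=
  ∀ n : ℕ, ∃ C > 0, ∃ δ > 0, ∀ x : E3, 0 < ‖x‖ → ‖x‖ < δ → |f x| ≤ C * ‖x‖ ^ n

lemma ContDiffAt.pd {f : E3 → ℝ} (hf : ContDiffAt ℝ (⊤ : ℕ∞) f 0) (i : Fin 3) :
    ContDiffAt ℝ (⊤ : ℕ∞) (pd i f) 0 :=
  (hf.fderiv_right (m := (⊤ : ℕ∞)) (by simp)).clm_apply contDiffAt_const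

lemma ContDiffAt.exists_lipschitz_ball {f : E3 → ℝ} (hf : ContDiffAt ℝ (⊤ : ℕ∞) f 0) :
    ∃ L > 0, ∃ δ > 0, ∀ x y : E3, ‖x‖ < δ → ‖y‖ < δ → |f x - f y| ≤ L * ‖x - y‖ := by
  obtain ⟨K, s, hs, hK⟩ := (hf.of_le (m := 1) (by norm_cast)).exists_lipschitzOnWith
  obtain ⟨δ, hδ, hsub⟩ := Metric.mem_nhds_iff.1 hs
  refine ⟨K + 1, by positivity, δ, hδ, fun x y hx hy => ?_⟩
  have h := hK.dist_le_mul x (hsub (by simpa using hx)) y (hsub (by simpa using hy))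
  rw [Real.dist_eq, dist_eq_norm] at h
  nlinarith [norm_nonneg (x - y)]

lemma FlatAtZero.pd {f : E3 → ℝ} (hf : ContDiffAt ℝ (⊤ : ℕ∞) f 0) (hflat : FlatAtZero f)
    (i : Fin 3) : FlatAtZero (pd i f) := by
  intro n
  obtain ⟨L, hL, δ₁, hδ₁, hLip⟩ := (hf.pd i).exists_lipschitz_ball
  obtain ⟨C, hC, δ₂, hδ₂, hfC⟩ := hflat (2 * n + 1)
  obtain ⟨δ₃, hδ₃, hdiff⟩ : ∃ δ > 0, ∀ x : E3, ‖x‖ < δ → DifferentiableAt ℝ f x := by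
    have h := (hf.of_le (m := 1) (by norm_cast)).eventually (by simp)
    obtain ⟨δ, hδ, h⟩ := Metric.eventually_nhds_iff.1 h
    exact ⟨δ, hδ, fun x hx => (h (by simpa using hx)).differentiableAt (by simp)⟩
  refine ⟨2 * C * (2 ^ (2 * n + 1) + 1) + L, by positivity,
    min 1 (min δ₁ (min δ₂ δ₃) / 2), by positivity, fun x hx0 hx => ?_⟩
  obtain ⟨hx1, hx⟩ := lt_min_iff.1 hx
  have hxδ : 2 * ‖x‖ < min δ₁ (min δ₂ δ₃) := by linarith
  obtain ⟨h₁, h₂₃⟩ := lt_min_iff.1 hxδ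
  obtain ⟨h₂, h₃⟩ := lt_min_iff.1 h₂₃
  set r := ‖x‖ with hr
  set e : E3 := EuclideanSpace.single i 1 with he
  have hnorm_e : ‖e‖ = 1 := by simp [he]
  set s : ℝ := r ^ (n + 1) / 2 with hs
  have hs0 : 0 < s := by positivity
  have hsr : s ≤ r / 2 := by
    have : r ^ (n + 1) ≤ r := pow_le_of_le_one hx0.le hx1.le (by simp)
    linarith
  have hse : ∀ τ, 0 ≤ τ → τ ≤ s → ‖τ • e‖ = τ := fun τ h0 _ => by
    rw [norm_smul, hnorm_e, mul_one, Real.norm_of_nonneg h0]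
  have hup : ∀ τ, 0 ≤ τ → τ ≤ s → ‖x + τ • e‖ ≤ 2 * r := fun τ h0 h1 => by
    have := norm_add_le x (τ • e)
    rw [hse τ h0 h1] at this
    linarith
  have hlow : 0 < ‖x + s • e‖ := by
    have := norm_sub_le (x + s • e) (s • e)
    rw [add_sub_cancel_right, hse s hs0.le le_rfl] at this
    linarith
  have hderiv : ∀ τ ∈ Set.Icc 0 s,
      HasDerivAt (fun τ : ℝ => f (x + τ • e)) (_root_.pd i f (x + τ • e)) τ := by
    intro τ hτ
    have h := (hdiff (x + τ • e) ((hup τ hτ.1 hτ.2).trans_lt h₃)).hasFDerivAt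
    have hline : HasDerivAt (fun τ : ℝ => x + τ • e) e τ := by
      simpa using ((hasDerivAt_id τ).smul_const e).const_add x
    exact h.comp_hasDerivAt τ hline
  obtain ⟨θ, hθ, hmvt⟩ := exists_hasDerivAt_eq_slope (fun τ : ℝ => f (x + τ • e))
    (fun τ => _root_.pd i f (x + τ • e)) hs0
    (fun τ hτ => (hderiv τ hτ).continuousAt.continuousWithinAt)
    (fun τ hτ => hderiv τ (Set.Ioo_subset_Icc_self hτ))
  simp only [zero_smul, add_zero, sub_zero] at hmvt
  have hl := hLip x (x + θ • e) (by linarith) ((hup θ hθ.1.le hθ.2.le).trans_lt h₁)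
  rw [sub_add_cancel_left, norm_neg, hse θ hθ.1.le hθ.2.le] at hl
  have hf1 := hfC x hx0 (by linarith)
  have hf2 : |f (x + s • e)| ≤ C * (2 * r) ^ (2 * n + 1) :=
    (hfC _ hlow ((hup s hs0.le le_rfl).trans_lt h₂)).trans
      (by gcongr; exact hup s hs0.le le_rfl)
  have hslope : |_root_.pd i f (x + θ • e)| ≤ 2 * C * (2 ^ (2 * n + 1) + 1) * r ^ n := by
    rw [hmvt, abs_div, abs_of_pos hs0, div_le_iff₀ hs0]
    calc |f (x + s • e) - f x| ≤ |f (x + s • e)| + |f x| := abs_sub _ _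
      _ ≤ C * (2 * r) ^ (2 * n + 1) + C * r ^ (2 * n + 1) := add_le_add hf2 hf1
      _ = _ := by rw [hs]; ring
  have hLθ : L * θ ≤ L * r ^ n := by
    gcongr
    have : r ^ (n + 1) ≤ r ^ n := pow_le_pow_of_le_one hx0.le hx1.le (by simp)
    have := hθ.2
    have : 0 < r ^ n := by positivity
    linarith
  calc |_root_.pd i f x|
      = |_root_.pd i f (x + θ • e) + (_root_.pd i f x - _root_.pd i f (x + θ • e))| := by
        congr 1; ring
    _ ≤ _ := abs_add_le _ _
    _ ≤ _ := by linarith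

lemma FlatAtZero.iterate_pd {f : E3 → ℝ} (hf : ContDiffAt ℝ (⊤ : ℕ∞) f 0)
    (hflat : FlatAtZero f) (i : Fin 3) (m : ℕ) :
    ContDiffAt ℝ (⊤ : ℕ∞) ((_root_.pd i)^[m] f) 0 ∧ FlatAtZero ((_root_.pd i)^[m] f) := by
  induction m with
  | zero => exact ⟨hf, hflat⟩
  | succ m ih =>
    rw [Function.iterate_succ_apply']
    exact ⟨ih.1.pd i, ih.2.pd ih.1 i⟩

lemma FlatAtZero.mpd {f : E3 → ℝ} (hf : ContDiffAt ℝ (⊤ : ℕ∞) f 0)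
    (hflat : FlatAtZero f) (β : Fin 3 → ℕ) : FlatAtZero (mpd β f) := by
  obtain ⟨hf₂, h₂⟩ := hflat.iterate_pd hf 2 (β 2)
  obtain ⟨hf₁, h₁⟩ := h₂.iterate_pd hf₂ 1 (β 1)
  exact (h₁.iterate_pd hf₁ 0 (β 0)).2

lemma isCompact_annulus (a b : ℝ) : IsCompact {y : E3 | a ≤ ‖y‖ ∧ ‖y‖ ≤ b} :=
  (isCompact_closedBall (0 : E3) b).of_isClosed_subset
    ((isClosed_le continuous_const continuous_norm).inter
      (isClosed_le continuous_norm continuous_const))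
    (fun y hy => by simpa using hy.2)

/-- A smooth function whose `L²` norms on dyadic annuli decay faster than any power of the
radius vanishes to infinite order. -/
lemma flatAtZero_of_integral_sq_le {f : E3 → ℝ} (hf : ContDiffAt ℝ (⊤ : ℕ∞) f 0)
    (hint : ∀ n : ℕ, ∃ C > 0, ∃ δ > 0, ∀ R : ℝ, 0 < R → R < δ →
      IntegrableOn (fun x => f x ^ 2) {y : E3 | R ≤ ‖y‖ ∧ ‖y‖ ≤ 2 * R} ∧
      ∫ x in {y : E3 | R ≤ ‖y‖ ∧ ‖y‖ ≤ 2 * R}, f x ^ 2 ≤ C * R ^ n) : FlatAtZero f := by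
  intro n
  obtain ⟨L, hL, δ₁, hδ₁, hLip⟩ := hf.exists_lipschitz_ball
  obtain ⟨C, hC, δ₂, hδ₂, hfC⟩ := hint (5 * n + 3)
  set H : ℝ := |f 0| + L with hH
  have hH0 : 0 < H := by positivity
  set ε : ℝ := 1 / (3 * H + 2 * L) with hε
  have hε0 : 0 < ε := by positivity
  set v : ℝ := volume.real (ball (0 : E3) 1) with hv
  have hv0 : 0 < v := ENNReal.toReal_pos (measure_ball_pos volume _ one_pos).ne'
    measure_ball_lt_top.ne
  set D : ℝ := 4 * C / (ε ^ 3 * v) with hD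
  have hD0 : 0 < D := by positivity
  refine ⟨D + 1, by positivity, min 1 (min (δ₁ / 2) δ₂), by positivity, fun x hx0 hx => ?_⟩
  obtain ⟨hx1, hx⟩ := lt_min_iff.1 hx
  obtain ⟨h₁, h₂⟩ := lt_min_iff.1 hx
  set r := ‖x‖ with hr
  set h := |f x| with hh
  rcases (abs_nonneg (f x)).eq_or_lt with hz | hpos
  · rw [hh, ← hz]; positivity
  have hhH : h ≤ H := by
    have h3 := hLip x 0 (by linarith) (by simpa using hδ₁)
    rw [sub_zero, ← hr] at h3
    have h4 : |f x| - |f 0| ≤ |f x - f 0| := abs_sub_abs_le_abs_sub _ _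
    nlinarith
  set s : ℝ := ε * h * r with hs
  have hs0 : 0 < s := by positivity
  have hs1 : s ≤ r / 3 := by
    have : ε * h ≤ 1 / 3 := by
      rw [hε, one_div_mul_eq_div, div_le_div_iff₀ (by positivity) (by positivity)]
      nlinarith
    nlinarith
  have hs2 : L * s ≤ h / 2 := by
    have h3 : L * ε ≤ 1 / 2 := by
      rw [hε, mul_one_div, div_le_div_iff₀ (by positivity) (by positivity)]
      nlinarith
    calc L * s = (L * ε) * (h * r) := by rw [hs]; ring
      _ ≤ 1 / 2 * (h * 1) := by gcongr
      _ = _ := by ring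
  set R : ℝ := 2 * r / 3 with hR
  obtain ⟨hI, hle⟩ := hfC R (by positivity) (by linarith)
  set A : Set E3 := {y : E3 | R ≤ ‖y‖ ∧ ‖y‖ ≤ 2 * R} with hA
  have hnear : ∀ y ∈ ball x s, ‖y - x‖ < s := fun y hy => by simpa [dist_eq_norm] using hy
  have hballA : ball x s ⊆ A := by
    intro y hy
    have h3 := hnear y hy
    have h4 := abs_norm_sub_norm_le y x
    have h5 := abs_le.1 (h4.trans h3.le)
    rw [← hr] at h5
    constructor <;> linarith [h5.1, h5.2]
  have hbig : ∀ y ∈ ball x s, (h / 2) ^ 2 ≤ f y ^ 2 := by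
    intro y hy
    have h3 := hnear y hy
    have h6 : ‖y‖ < δ₁ := by
      have := (hballA hy).2
      linarith
    have h4 := hLip x y (by linarith) h6
    rw [norm_sub_rev] at h4
    have h5 : |f x| - |f y| ≤ |f x - f y| := abs_sub_abs_le_abs_sub _ _
    have h7 : L * ‖y - x‖ ≤ L * s := by gcongr
    rw [← sq_abs (f y)]
    gcongr
    linarith
  have hvol : volume.real (ball x s) = s ^ 3 * v := by
    rw [hv, measureReal_def, Measure.addHaar_ball_of_pos _ _ hs0, ENNReal.toReal_mul,
      ENNReal.toReal_ofReal (by positivity), finrank_euclideanSpace, Fintype.card_fin]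
    rfl
  have hlower : (h / 2) ^ 2 * (s ^ 3 * v) ≤ C * R ^ (5 * n + 3) := by
    calc (h / 2) ^ 2 * (s ^ 3 * v) = ∫ _ in ball x s, (h / 2) ^ 2 := by
          rw [setIntegral_const, hvol, smul_eq_mul, mul_comm]
      _ ≤ ∫ y in ball x s, f y ^ 2 :=
          setIntegral_mono_on (integrableOn_const measure_ball_lt_top.ne)
            (hI.mono_set hballA) measurableSet_ball hbig
      _ ≤ ∫ y in A, f y ^ 2 :=
          setIntegral_mono_set hI (Filter.Eventually.of_forall fun _ => sq_nonneg _)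
            hballA.eventuallyLE
      _ ≤ _ := hle
  have hRr : R ^ (5 * n + 3) ≤ r ^ (5 * n + 3) := by
    gcongr
    linarith
  have hkey : h ^ 5 ≤ D * (r ^ n) ^ 5 := by
    rw [hD, div_mul_eq_mul_div, le_div_iff₀ (by positivity)]
    have h3 : (h / 2) ^ 2 * (s ^ 3 * v) ≤ C * r ^ (5 * n + 3) :=
      hlower.trans (by gcongr)
    have h4 : (h / 2) ^ 2 * (s ^ 3 * v) = (h ^ 5 * (ε ^ 3 * v) / 4) * r ^ 3 := by
      rw [hs]; ring
    have h5 : C * r ^ (5 * n + 3) = (C * (r ^ n) ^ 5) * r ^ 3 := by ring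
    rw [h4, h5] at h3
    have := le_of_mul_le_mul_right h3 (by positivity)
    linarith
  refine le_of_pow_le_pow_left₀ (n := 5) (by simp) (by positivity) (hkey.trans ?_)
  rw [mul_pow]
  gcongr
  calc D ≤ D + 1 := by linarith
    _ ≤ (D + 1) ^ 5 := le_self_pow₀ (by linarith) (by simp)

lemma FlatAtZero.integral_sum_sq_le {ι : Type*} [Fintype ι] {g : ι → E3 → ℝ}
    (hg : ∀ i, FlatAtZero (g i)) (m : ℕ) (N : ℝ) :
    ∃ C > 0, ∃ δ > 0, ∀ R : ℝ, 0 < R → R < δ →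
      ∫ x in {y : E3 | R ≤ ‖y‖ ∧ ‖y‖ ≤ 2 * R}, R ^ m * ∑ i, g i x ^ 2 ≤ C * R ^ N := by
  obtain ⟨n, hn⟩ := exists_nat_ge N
  choose C hC δ hδ h using fun i => hg i n
  obtain ⟨δ', hδ', hδle⟩ : ∃ δ' > 0, ∀ i, δ' ≤ δ i := by
    have : ∀ᶠ d in nhdsWithin (0 : ℝ) (Set.Ioi 0), ∀ i, d ≤ δ i :=
      Filter.eventually_all.2 fun i =>
        Filter.Eventually.filter_mono nhdsWithin_le_nhds (eventually_le_nhds (hδ i))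
    obtain ⟨d, hd, hd0⟩ := (this.and self_mem_nhdsWithin).exists
    exact ⟨d, hd0, hd⟩
  set V : ℝ := volume.real (closedBall (0 : E3) 2) with hV
  set S : ℝ := ∑ i, (C i * 2 ^ n) ^ 2 with hS
  have hS0 : 0 ≤ S := Finset.sum_nonneg fun i _ => sq_nonneg _
  have hV0 : 0 ≤ V := measureReal_nonneg
  refine ⟨S * V + 1, by positivity, min 1 (δ' / 2), by positivity, fun R hR0 hR => ?_⟩
  obtain ⟨hR1, hR2⟩ := lt_min_iff.1 hR
  set A : Set E3 := {y : E3 | R ≤ ‖y‖ ∧ ‖y‖ ≤ 2 * R} with hA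
  have hAfin : volume A < ⊤ := (isCompact_annulus R (2 * R)).measure_lt_top
  have hAV : volume.real A ≤ V := by
    refine measureReal_mono (fun y hy => ?_) measure_closedBall_lt_top.ne
    have := hy.2
    simp only [mem_closedBall, dist_zero_right]
    linarith
  have hbound : ∀ x ∈ A, ‖R ^ m * ∑ i, g i x ^ 2‖ ≤ S * R ^ n := by
    intro x hx
    have hsum : ∑ i, g i x ^ 2 ≤ S * R ^ n := by
      rw [hS, Finset.sum_mul]
      refine Finset.sum_le_sum fun i _ => ?_
      have h1 := h i x (hR0.trans_le hx.1) (by linarith [hx.2, hδle i])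
      have h2 : |g i x| ≤ C i * (2 * R) ^ n :=
        h1.trans (mul_le_mul_of_nonneg_left (pow_le_pow_left₀ (norm_nonneg _) hx.2 n) (hC i).le)
      calc g i x ^ 2 = |g i x| ^ 2 := (sq_abs _).symm
        _ ≤ (C i * (2 * R) ^ n) ^ 2 := by gcongr
        _ = (C i * 2 ^ n) ^ 2 * R ^ n * R ^ n := by ring
        _ ≤ (C i * 2 ^ n) ^ 2 * R ^ n * 1 := by gcongr; exact pow_le_one₀ hR0.le hR1.le
        _ = _ := mul_one _
    have hsum0 : 0 ≤ ∑ i, g i x ^ 2 := Finset.sum_nonneg fun i _ => sq_nonneg _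
    rw [Real.norm_of_nonneg (by positivity)]
    calc R ^ m * ∑ i, g i x ^ 2 ≤ 1 * ∑ i, g i x ^ 2 := by
          gcongr; exact pow_le_one₀ hR0.le hR1.le
      _ ≤ _ := by rwa [one_mul]
  have hRn : R ^ n ≤ R ^ N := by
    rw [← Real.rpow_natCast]
    exact Real.rpow_le_rpow_of_exponent_ge hR0 hR1.le hn
  calc ∫ x in A, R ^ m * ∑ i, g i x ^ 2
      ≤ ‖∫ x in A, R ^ m * ∑ i, g i x ^ 2‖ := le_abs_self _
    _ ≤ S * R ^ n * volume.real A := norm_setIntegral_le_of_norm_le_const hAfin hbound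
    _ ≤ S * R ^ N * V := by gcongr
    _ ≤ (S * V + 1) * R ^ N := by nlinarith [Real.rpow_pos_of_pos hR0 N]


/-- **Interior flatness of derivatives** (Lemma 3.1).  If `u` is a smooth
solution of the residual stress system with smooth coefficients, uniformly
elliptic `P₁, P₂`, and `∫_{R≤|x|≤2R}|u|² = O(R^N)` as `R → 0` for every `N`,
then `∫_{R≤|x|≤2R} R^{2|β|}|∂^β u|² = O(R^N)` for every `|β| ≤ 2` and every `N`. -/
theorem derivative_flatness_second_order
    (Ω : Set E3) (hΩopen : IsOpen Ω) (hΩconn : IsConnected Ω) (h0Ω : (0 : E3) ∈ Ω)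
    (κ : ℝ) (t : Fin 3 → Fin 3 → E3 → ℝ) (lam mu rho : E3 → ℝ)
    (htsym : ∀ j k : Fin 3, ∀ x ∈ Ω, t j k x = t k j x)
    (hdivT : ∀ x ∈ Ω, ∀ i : Fin 3, (∑ j, pd j (t i j) x) = 0)
    (hrho : ∀ x ∈ Ω, 0 < rho x)
    (hsmooth : (∀ j k : Fin 3, ContDiffOn ℝ (⊤ : ℕ∞) (t j k) Ω) ∧ ContDiffOn ℝ (⊤ : ℕ∞) lam Ω ∧
      ContDiffOn ℝ (⊤ : ℕ∞) mu Ω ∧ ContDiffOn ℝ (⊤ : ℕ∞) rho Ω)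
    (hell1 : UnifElliptic (a1coef t mu) Ω) (hell2 : UnifElliptic (a2coef t lam mu) Ω)
    (u : E3 → Fin 3 → ℝ) (hu : ∀ i : Fin 3, ContDiffOn ℝ (⊤ : ℕ∞) (fun x => u x i) Ω)
    (hsol : ResSystem t lam mu rho κ u Ω)
    (hflat : ∀ N : ℝ, 0 < N → ∃ C > 0, ∃ δ > 0, ∀ R : ℝ, 0 < R → R < δ →
      (∫ x in {y : E3 | R ≤ ‖y‖ ∧ ‖y‖ ≤ 2 * R}, ∑ i, (u x i) ^ 2) ≤ C * R ^ N) :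
    ∀ β : Fin 3 → ℕ, mdeg β ≤ 2 → ∀ N : ℝ, 0 < N → ∃ C > 0, ∃ δ > 0,
      ∀ R : ℝ, 0 < R → R < δ →
        (∫ x in {y : E3 | R ≤ ‖y‖ ∧ ‖y‖ ≤ 2 * R},
            R ^ (2 * mdeg β) * ∑ i, (mpd β (fun y => u y i) x) ^ 2) ≤ C * R ^ N := by
  intro β _ N _
  have hcd : ∀ i, ContDiffAt ℝ (⊤ : ℕ∞) (fun x => u x i) 0 := fun i =>
    (hu i).contDiffAt (hΩopen.mem_nhds h0Ω)
  obtain ⟨δ₀, hδ₀, hball⟩ := Metric.isOpen_iff.1 hΩopen 0 h0Ω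
  refine FlatAtZero.integral_sum_sq_le (g := fun i => mpd β (fun y => u y i))
    (fun i => FlatAtZero.mpd (hcd i) (flatAtZero_of_integral_sq_le (hcd i) fun n => ?_) β)
    (2 * mdeg β) N
  obtain ⟨C, hC, δ, hδ, h⟩ := hflat (n + 1 : ℕ) (by positivity)
  refine ⟨C, hC, min 1 (min δ (δ₀ / 2)), by positivity, fun R hR0 hR => ?_⟩
  obtain ⟨hR1, hR⟩ := lt_min_iff.1 hR
  obtain ⟨hRδ, hRδ₀⟩ := lt_min_iff.1 hR
  have hint : ∀ j, IntegrableOn (fun x => u x j ^ 2) {y : E3 | R ≤ ‖y‖ ∧ ‖y‖ ≤ 2 * R} :=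
    fun j => (((hu j).continuousOn.mono fun y hy => hball (by
      have := hy.2
      simp only [mem_ball, dist_zero_right]
      linarith)).pow 2).integrableOn_compact (isCompact_annulus R (2 * R))
  refine ⟨hint i, ?_⟩
  calc _ ≤ ∫ x in {y : E3 | R ≤ ‖y‖ ∧ ‖y‖ ≤ 2 * R}, ∑ j, u x j ^ 2 :=
        setIntegral_mono (hint i) (integrable_finsetSum _ fun j _ => hint j) fun x =>
          Finset.single_le_sum (f := fun j => u x j ^ 2) (fun j _ => sq_nonneg _)
            (Finset.mem_univ i)
    _ ≤ C * R ^ ((n + 1 : ℕ) : ℝ) := h R hR0 hRδ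
    _ = C * R ^ (n + 1) := by rw [Real.rpow_natCast]
    _ ≤ C * R ^ n := by
        gcongr ?_ * ?_
        exact pow_le_pow_of_le_one hR0.le hR1.le (by simp)
end
end
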